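/- arXiv:0904.3548 — 2 statements merged into one kernel-verified Lean document; each statement's English description precedes it below -/
import Mathlib

section
/- For each μ ∈ {μ₁, μ₂}, Perm^sp(μ) = Perm(μ); that is, an element w ∈ W̃ is μ-spin-permissible if and only if w lies in t_μ W_a and wx − x ∈ Conv(W°μ) for every x in the closure of the base alcove Ã. -/
open Finset

namespace OrthLM

/-- Membership in the cocharacter lattice `X` of the standard maximal torus of `GO_{2n}`:
integer vectors with `r_i + r_{i*}` independent of `i`. -/
def inX (n : ℕ) (v : Fin (2*n) → ℤ) : Prop :=
  ∀ i j : Fin (2*n), v i + v i.rev = v j + v j.rev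

/-- Membership in `S^h_{2n}`: permutations commuting with the involution `i ↦ i* = 2n+1-i`. -/
def inSh (n : ℕ) (σ : Equiv.Perm (Fin (2*n))) : Prop :=
  ∀ i, σ i.rev = (σ i).rev

/-- Membership in `W°`: elements of `S^h_{2n}` that are even as permutations. -/
def inW0 (n : ℕ) (σ : Equiv.Perm (Fin (2*n))) : Prop :=
  inSh n σ ∧ Equiv.Perm.sign σ = 1

/-- Elements of the ambient group of the Iwahori-Weyl group `W̃ = X ⋊ S^h_{2n}`,
represented as pairs (translation part, finite part). -/
abbrev Wt (n : ℕ) := (Fin (2*n) → ℤ) × Equiv.Perm (Fin (2*n))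

/-- Membership in the Iwahori-Weyl group `W̃ = X ⋊ S^h_{2n}`. -/
def inWt (n : ℕ) (w : Wt n) : Prop := inX n w.1 ∧ inSh n w.2

def wone (n : ℕ) : Wt n := (0, 1)

/-- Multiplication in `W̃` (compatible with the affine action `(v,σ)·x = v + σx`). -/
def wmul (n : ℕ) (w w' : Wt n) : Wt n :=
  (fun i => w.1 i + w'.1 (w.2⁻¹ i), w.2 * w'.2)

/-- Inversion in `W̃`. -/
def winv (n : ℕ) (w : Wt n) : Wt n := (fun i => -(w.1 (w.2 i)), w.2⁻¹)

/-- The translation element `t_μ`. -/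
def wtrans (n : ℕ) (μ : Fin (2*n) → ℤ) : Wt n := (μ, 1)

/-- A finite Weyl group element regarded in `W̃`. -/
def wperm (n : ℕ) (σ : Equiv.Perm (Fin (2*n))) : Wt n := (0, σ)

/-- The affine action of `W̃` on `ℤ^{2n}`: `(v,σ)·x = v + σx` with `(σx)(i) = x(σ⁻¹ i)`. -/
def wact (n : ℕ) (w : Wt n) (x : Fin (2*n) → ℤ) : Fin (2*n) → ℤ :=
  fun i => w.1 i + x (w.2⁻¹ i)

/-- The affine action of `W̃` on `ℝ^{2n}`. -/
def wactR (n : ℕ) (w : Wt n) (x : Fin (2*n) → ℝ) : Fin (2*n) → ℝ :=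
  fun i => (w.1 i : ℝ) + x (w.2⁻¹ i)

/-- The action of a permutation on vectors: `(σμ)(i) = μ(σ⁻¹ i)`. -/
def permAct (n : ℕ) (σ : Equiv.Perm (Fin (2*n))) (μ : Fin (2*n) → ℤ) : Fin (2*n) → ℤ :=
  fun i => μ (σ⁻¹ i)

/-- The cocharacter `μ₁ = (1^{(n)}, 0^{(n)})`. -/
def mu1 (n : ℕ) : Fin (2*n) → ℤ := fun j => if (j:ℕ) < n then 1 else 0

/-- The cocharacter `μ₂ = (1^{(n-1)}, 0, 1, 0^{(n-1)})`. -/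
def mu2 (n : ℕ) : Fin (2*n) → ℤ := fun j => if (j:ℕ) < n - 1 ∨ (j:ℕ) = n then 1 else 0

/-- The vertices `ω_k = ((-1)^{(k)}, 0^{(2n-k)})` of the standard extended alcove. -/
def om (n : ℕ) (k : ℕ) : Fin (2*n) → ℤ := fun j => if (j:ℕ) < k then -1 else 0

/-- The extended alcove `v_k = w·ω_k` of `w`. -/
def valc (n : ℕ) (w : Wt n) (k : ℕ) : Fin (2*n) → ℤ := wact n w (om n k)

/-- The vector `μ_k^w = v_k - ω_k`. -/
def muk (n : ℕ) (w : Wt n) (k : ℕ) : Fin (2*n) → ℤ :=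
  fun j => valc n w k j - om n k j

/-- The set `E_k^w = {j : μ_k^w(j) = 0}`. -/
def Ew (n : ℕ) (w : Wt n) (k : ℕ) : Finset (Fin (2*n)) :=
  univ.filter fun j => muk n w k j = 0

/-- `GL`-permissibility: `Σ v_0 = n` and `ω_k ≤ v_k ≤ ω_k + (1,…,1)` for `0 ≤ k ≤ 2n-1`. -/
def GLperm (n : ℕ) (w : Wt n) : Prop :=
  (∑ j, valc n w 0 j) = (n : ℤ) ∧
  ∀ k < 2*n, ∀ j, om n k j ≤ valc n w k j ∧ valc n w k j ≤ om n k j + 1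

/-- A vector `μ ∈ {0,1}^{2n}` is totally isotropic if `μ(j) + μ(j*) = 1` for all `j`. -/
def TotIso (n : ℕ) (μ : Fin (2*n) → ℤ) : Prop := ∀ j, μ j + μ j.rev = 1

/-- `μ`-spin-permissibility: `GL`-permissible and every totally isotropic `μ_k^w`
(for `0 ≤ k ≤ n`) lies in the `W°`-orbit of `μ`. -/
def SpinPerm (n : ℕ) (μ : Fin (2*n) → ℤ) (w : Wt n) : Prop :=
  GLperm n w ∧ ∀ k ≤ n, TotIso n (muk n w k) →
    ∃ σ, inW0 n σ ∧ muk n w k = permAct n σ μ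

/-- Membership in the coroot lattice `Q^∨`. -/
def inQv (n : ℕ) (v : Fin (2*n) → ℤ) : Prop :=
  inX n v ∧ (∀ i, v i + v i.rev = 0) ∧
  Even (∑ i ∈ univ.filter (fun i : Fin (2*n) => (i:ℕ) < n), v i)

/-- Membership in the affine Weyl group `W_a = Q^∨ ⋊ W°`. -/
def inWa (n : ℕ) (x : Wt n) : Prop := inQv n x.1 ∧ inW0 n x.2

/-- The affine reflection `s_{i,j;d}` (for `j ∉ {i, i*}`), sending `x` to the vector with
`x_j + d` in slot `i`, `x_i - d` in slot `j`, `x_{i*} + d` in slot `j*`, `x_{j*} - d` in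
slot `i*`. -/
def wrefl (n : ℕ) (i j : Fin (2*n)) (d : ℤ) : Wt n :=
  (fun l => if l = i then d else if l = j then -d else if l = j.rev then d
            else if l = i.rev then -d else 0,
   Equiv.swap i j * Equiv.swap i.rev j.rev)

/-- Successor modulo `2n` on representatives `{0,…,2n-1}` of `ℤ/2nℤ`. -/
def csucc (n : ℕ) (k : Fin (2*n)) : Fin (2*n) :=
  ⟨((k:ℕ) + 1) % (2*n), Nat.mod_lt _ k.pos⟩

/-- Predecessor modulo `2n`. -/
def cpred (n : ℕ) (k : Fin (2*n)) : Fin (2*n) :=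
  ⟨((k:ℕ) + (2*n - 1)) % (2*n), Nat.mod_lt _ k.pos⟩

/-- Negation modulo `2n`. -/
def cneg (n : ℕ) (k : Fin (2*n)) : Fin (2*n) :=
  ⟨(2*n - (k:ℕ)) % (2*n), Nat.mod_lt _ k.pos⟩

/-- The star involution on classes mod `2n`: the class of `m` goes to the class of
`m* = 2n+1-m`, i.e. `c ↦ 1 - c`. -/
def cstar (n : ℕ) (k : Fin (2*n)) : Fin (2*n) := csucc n (cneg n k)

/-- The representative in `{1,…,2n}` of a class mod `2n`. -/
def pv (n : ℕ) (k : Fin (2*n)) : ℕ := if (k:ℕ) = 0 then 2*n else (k:ℕ)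

/-- The cyclic interval `[a, b)` in `ℤ/2nℤ`. -/
def cyc (n : ℕ) (a b : Fin (2*n)) : Finset (Fin (2*n)) :=
  univ.filter fun k => ((k:ℕ) + 2*n - (a:ℕ)) % (2*n) < ((b:ℕ) + 2*n - (a:ℕ)) % (2*n)

/-- The set `K_m = {k ∈ ℤ/2nℤ : μ_k^w(m) = 0}` (indices `m` are 0-indexed: the slot `m`
corresponds to the paper's `m+1 ∈ {1,…,2n}`; classes are represented by `{0,…,2n-1}`). -/
def Kset (n : ℕ) (w : Wt n) (m : Fin (2*n)) : Finset (Fin (2*n)) :=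
  univ.filter fun k => muk n w (k:ℕ) m = 0

/-- The slot `m` is proper: `K_{m+1}` (paper indexing) is a cyclic interval `[m̃, m+1)`
with lower endpoint `m̃` different from the class of `m+1`. -/
def isProper (n : ℕ) (w : Wt n) (m : Fin (2*n)) : Prop :=
  ∃ mt, mt ≠ csucc n m ∧ Kset n w m = cyc n mt (csucc n m)

/-- The constraint cutting out `X ⊗ ℝ` inside `ℝ^{2n}`. -/
def inXR (n : ℕ) (x : Fin (2*n) → ℝ) : Prop :=
  ∀ i j : Fin (2*n), x i + x i.rev = x j + x j.rev

/-- The closure (in `X ⊗ ℝ`, lifted to `ℝ^{2n}`) of the preimage `Ã` of the base alcove: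
the points of `X ⊗ ℝ` on which every positive root `x_i - x_j`, `x_i + x_j - c(x)`
(`1 ≤ i < j ≤ n`) takes values in `[-1, 0]`. -/
def ClA (n : ℕ) : Set (Fin (2*n) → ℝ) :=
  {x | inXR n x ∧
       ∀ i j : Fin (2*n), i < j → (j:ℕ) < n →
         (-1 ≤ x i - x j ∧ x i - x j ≤ 0 ∧
          -1 ≤ x i + x j - (x i + x i.rev) ∧ x i + x j - (x i + x i.rev) ≤ 0)}

/-- The stabilizer `Ω` in `W̃` of the base alcove. -/
def inOmega (n : ℕ) (w : Wt n) : Prop :=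
  inWt n w ∧ (wactR n w) '' ClA n = ClA n

/-- The Coxeter generators of `W_a`: the reflections in the walls of the base alcove,
namely `s_{i,i+1;0}` for `1 ≤ i ≤ n-1`, `s_{n-1,n+1;0}`, and `s_{1,2n-1;-1}`
(paper 1-indexed; here 0-indexed). -/
def sgens (n : ℕ) (hn : 2 ≤ n) : Set (Wt n) :=
  {w | (∃ i : Fin (2*n), (i:ℕ) + 1 < n ∧ w = wrefl n i (csucc n i) 0) ∨
       w = wrefl n ⟨n-2, by omega⟩ ⟨n, by omega⟩ 0 ∨
       w = wrefl n ⟨0, by omega⟩ ⟨2*n-2, by omega⟩ (-1)}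

def wprod (n : ℕ) (L : List (Wt n)) : Wt n := L.foldr (wmul n) (wone n)

/-- A word in the Coxeter generators of `W_a`. -/
def isWord (n : ℕ) (hn : 2 ≤ n) (L : List (Wt n)) : Prop := ∀ s ∈ L, s ∈ sgens n hn

/-- The length function on `W̃`: `ℓ(xω) = ℓ(x)` for `x ∈ W_a`, `ω ∈ Ω`, where `ℓ(x)` is
the minimal length of a word in the Coxeter generators expressing `x`. -/
noncomputable def lenW (n : ℕ) (hn : 2 ≤ n) (w : Wt n) : ℕ :=
  sInf {m | ∃ L ω, isWord n hn L ∧ L.length = m ∧ inOmega n ω ∧ w = wmul n (wprod n L) ω}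

/-- The Bruhat order on `W̃`: `xω ≤ x'ω'` iff `ω = ω'` and `x ≤ x'` in `W_a`, the latter
expressed by the subword property for a reduced word of `x'`. -/
def wle (n : ℕ) (hn : 2 ≤ n) (w w' : Wt n) : Prop :=
  ∃ L ω, isWord n hn L ∧ inOmega n ω ∧ w' = wmul n (wprod n L) ω ∧
    L.length = lenW n hn w' ∧ ∃ L', L'.Sublist L ∧ w = wmul n (wprod n L') ω

/-- Strict Bruhat order on `W̃`. -/
def wlt (n : ℕ) (hn : 2 ≤ n) (w w' : Wt n) : Prop := wle n hn w w' ∧ w ≠ w'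

/-- The `μ`-admissible set `Adm°(μ)` for `G°`: `w ≤ σ t_μ σ⁻¹` for some `σ ∈ W°`. -/
def AdmO (n : ℕ) (hn : 2 ≤ n) (μ : Fin (2*n) → ℤ) (w : Wt n) : Prop :=
  ∃ σ, inW0 n σ ∧
    wle n hn w (wmul n (wperm n σ) (wmul n (wtrans n μ) (wperm n σ⁻¹)))

/-- The `μ`-admissible set `Adm(μ)` for `G`: `w ≤ σ t_μ σ⁻¹` for some `σ ∈ S^h_{2n}`. -/
def AdmFull (n : ℕ) (hn : 2 ≤ n) (μ : Fin (2*n) → ℤ) (w : Wt n) : Prop :=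
  ∃ σ, inSh n σ ∧
    wle n hn w (wmul n (wperm n σ) (wmul n (wtrans n μ) (wperm n σ⁻¹)))

/-- The element `τ = (n, n+1) ∈ S^h_{2n}` (paper 1-indexed). -/
def tau (n : ℕ) (hn : 2 ≤ n) : Equiv.Perm (Fin (2*n)) :=
  Equiv.swap ⟨n-1, by omega⟩ ⟨n, by omega⟩

/-- The `μ`-permissible set of Kottwitz–Rapoport: `w ∈ t_μ W_a` and `wx - x ∈ Conv(W°μ)`
for every `x` in the closure of the base alcove `Ã ⊆ X ⊗ ℝ`. -/
def PermKR (n : ℕ) (μ : Fin (2*n) → ℤ) (w : Wt n) : Prop :=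
  (∃ x, inWa n x ∧ w = wmul n (wtrans n μ) x) ∧
  ∀ x ∈ ClA n, (fun i => wactR n w x i - x i) ∈
    convexHull ℝ {y : Fin (2*n) → ℝ | ∃ σ, inW0 n σ ∧ y = fun i => (permAct n σ μ i : ℝ)}

lemma inSh.inv {n : ℕ} {σ : Equiv.Perm (Fin (2*n))} (h : inSh n σ) : inSh n σ⁻¹ := by
  intro i
  rw [Equiv.Perm.inv_eq_iff_eq, h]
  simp

lemma inSh.mul {n : ℕ} {σ τ : Equiv.Perm (Fin (2*n))} (hσ : inSh n σ) (hτ : inSh n τ) :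
    inSh n (σ * τ) := fun i => by
  rw [Equiv.Perm.mul_apply, Equiv.Perm.mul_apply, hτ, hσ]

lemma ne_rev {n : ℕ} (i : Fin (2*n)) : i ≠ i.rev := by
  intro h
  have := congrArg Fin.val h
  rw [Fin.val_rev] at this
  omega

lemma rev_lt_iff {n : ℕ} (i : Fin (2*n)) : ((i.rev : Fin (2*n)) : ℕ) < n ↔ ¬ (i : ℕ) < n := by
  rw [Fin.val_rev]
  omega

lemma inSh_swap_rev {n : ℕ} (i : Fin (2*n)) : inSh n (Equiv.swap i i.rev) := by
  intro j
  by_cases h1 : j = i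
  · subst h1; simp
  by_cases h2 : j = i.rev
  · subst h2; simp
  rw [Equiv.swap_apply_of_ne_of_ne h1 h2, Equiv.swap_apply_of_ne_of_ne]
  · intro h; exact h2 (by rw [← h, Fin.rev_rev])
  · intro h; exact h1 (Fin.rev_injective h)

/-- The sum of the first `n` coordinates. -/
def halfSum (n : ℕ) (u : Fin (2*n) → ℤ) : ℤ :=
  ∑ i ∈ univ.filter (fun i : Fin (2*n) => (i:ℕ) < n), u i

/-- An element of `S^h_{2n}` is obtained from one preserving the first half
by multiplying with transpositions `(i, i*)`. -/
lemma inSh_induction {n : ℕ} {P : Equiv.Perm (Fin (2*n)) → Prop}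
    (hbase : ∀ σ, inSh n σ → (∀ i : Fin (2*n), (i:ℕ) < n → (σ i : ℕ) < n) → P σ)
    (hstep : ∀ (σ) (i : Fin (2*n)), (i:ℕ) < n → inSh n σ → P σ → P (σ * Equiv.swap i i.rev))
    (σ : Equiv.Perm (Fin (2*n))) (hσ : inSh n σ) : P σ := by
  induction hm : (univ.filter fun i : Fin (2*n) => (i:ℕ) < n ∧ ¬ (σ i : ℕ) < n).card
    generalizing σ with
  | zero =>
    refine hbase σ hσ fun i hi => ?_
    rw [Finset.card_eq_zero, Finset.filter_eq_empty_iff] at hm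
    by_contra hc
    exact hm (mem_univ i) ⟨hi, hc⟩
  | succ m ih =>
    obtain ⟨i, hi⟩ : (univ.filter fun i : Fin (2*n) =>
        (i:ℕ) < n ∧ ¬ (σ i : ℕ) < n).Nonempty := by
      rw [← Finset.card_pos]; omega
    have hi' := (Finset.mem_filter.1 hi).2
    have hτ : inSh n (σ * Equiv.swap i i.rev) := hσ.mul (inSh_swap_rev i)
    have hP := hstep _ i hi'.1 hτ (ih _ hτ ?_)
    · rwa [mul_assoc, Equiv.swap_mul_self, mul_one] at hP
    · have : (univ.filter fun j : Fin (2*n) =>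
          (j:ℕ) < n ∧ ¬ ((σ * Equiv.swap i i.rev) j : ℕ) < n) =
          (univ.filter fun i : Fin (2*n) => (i:ℕ) < n ∧ ¬ (σ i : ℕ) < n).erase i := by
        ext j
        rw [Finset.mem_erase, Finset.mem_filter, Finset.mem_filter, Equiv.Perm.mul_apply]
        simp only [mem_univ, true_and]
        by_cases h1 : j = i
        · subst h1
          rw [Equiv.swap_apply_left, hσ, rev_lt_iff]
          tauto
        · by_cases h2 : (j:ℕ) < n
          · have h3 : j ≠ i.rev := by
              rintro rfl
              exact (rev_lt_iff i).1 h2 hi'.1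
            rw [Equiv.swap_apply_of_ne_of_ne h1 h3]
            tauto
          · tauto
      rw [this, Finset.card_erase_of_mem hi, hm]; rfl

lemma sign_eq_one_of_preserves_half {n : ℕ} {σ : Equiv.Perm (Fin (2*n))} (hσ : inSh n σ)
    (h : ∀ i : Fin (2*n), (i:ℕ) < n → (σ i : ℕ) < n) : Equiv.Perm.sign σ = 1 := by
  have hiff : ∀ i : Fin (2*n), (σ i : ℕ) < n ↔ (i:ℕ) < n := fun i => by
    refine ⟨fun hi => ?_, h i⟩
    by_contra hc
    have := h _ ((rev_lt_iff i).2 hc)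
    rw [hσ, rev_lt_iff] at this
    exact this hi
  set ρ : Equiv.Perm (Fin (2*n)) :=
    Equiv.Perm.ofSubtype (σ.subtypePerm (p := fun i : Fin (2*n) => (i:ℕ) < n) hiff) with hρ
  have h1 : ∀ i : Fin (2*n), (i:ℕ) < n → ρ i = σ i := fun i hi => by
    exact Equiv.Perm.ofSubtype_apply_of_mem (σ.subtypePerm hiff) hi
  have h2 : ∀ i : Fin (2*n), ¬ (i:ℕ) < n → ρ i = i := fun i hi => by
    exact Equiv.Perm.ofSubtype_apply_of_not_mem (σ.subtypePerm hiff) hi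
  have key : σ = ρ * (Fin.revPerm * ρ * Fin.revPerm⁻¹) := by
    ext1 i
    simp only [Equiv.Perm.mul_apply]
    have : (Fin.revPerm⁻¹ : Equiv.Perm (Fin (2*n))) i = i.rev := rfl
    rw [this, Fin.revPerm_apply]
    by_cases hi : (i:ℕ) < n
    · rw [h2 i.rev (by rw [rev_lt_iff]; tauto), Fin.rev_rev, h1 i hi]
    · rw [h1 i.rev (by rwa [rev_lt_iff]), hσ, Fin.rev_rev, h2]
      rwa [hiff]
  rw [key]
  simp only [map_mul, map_inv]
  rw [mul_comm (Equiv.Perm.sign Fin.revPerm), mul_assoc (Equiv.Perm.sign ρ),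
    mul_inv_cancel, mul_one, Int.units_mul_self]

/-- The effect of `σ ∈ S^h_{2n}` on the parity of the sum of the first half. -/
lemma even_halfSum_comp {n : ℕ} {σ : Equiv.Perm (Fin (2*n))} (hσ : inSh n σ)
    {c : ℤ} {u : Fin (2*n) → ℤ} (hu : ∀ j, u j + u j.rev = c) :
    Even (halfSum n (fun j => u (σ j)) - halfSum n u -
      c * (if Equiv.Perm.sign σ = 1 then 0 else 1)) := by
  refine inSh_induction (P := fun σ => Even (halfSum n (fun j => u (σ j)) - halfSum n u -
      c * (if Equiv.Perm.sign σ = 1 then 0 else 1))) ?_ ?_ σ hσ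
  · intro σ hσ h
    have hs := sign_eq_one_of_preserves_half hσ h
    have hsum : halfSum n (fun j => u (σ j)) = halfSum n u := by
      unfold halfSum
      refine Finset.sum_nbij σ (fun i hi => ?_) σ.injective.injOn ?_ (fun _ _ => rfl)
      · simp only [Finset.mem_filter, mem_univ, true_and] at hi ⊢
        exact h i hi
      · apply Finset.surjOn_of_injOn_of_card_le _ _ σ.injective.injOn le_rfl
        intro i hi
        simp only [Finset.coe_filter, mem_univ, true_and, Set.mem_ofPred_eq] at hi ⊢
        exact h i hi
    simp [hs, hsum]
  · intro σ i hi hσ ih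
    have hmem : i ∈ univ.filter (fun i : Fin (2*n) => (i:ℕ) < n) := by simpa using hi
    have hsum : halfSum n (fun j => u ((σ * Equiv.swap i i.rev) j)) =
        halfSum n (fun j => u (σ j)) + (c - 2 * u (σ i)) := by
      unfold halfSum
      rw [← Finset.add_sum_erase _ _ hmem, ← Finset.add_sum_erase _ (fun j => u (σ j)) hmem]
      have : ∑ x ∈ (univ.filter (fun i : Fin (2*n) => (i:ℕ) < n)).erase i,
          u ((σ * Equiv.swap i i.rev) x) =
          ∑ x ∈ (univ.filter (fun i : Fin (2*n) => (i:ℕ) < n)).erase i, u (σ x) := by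
        refine Finset.sum_congr rfl fun j hj => ?_
        simp only [Finset.mem_erase, Finset.mem_filter, mem_univ, true_and] at hj
        rw [Equiv.Perm.mul_apply, Equiv.swap_apply_of_ne_of_ne hj.1]
        rintro rfl
        exact (rev_lt_iff i).1 hj.2 hi
      rw [this, Equiv.Perm.mul_apply, Equiv.swap_apply_left, hσ]
      have := hu (σ i)
      linarith
    rw [hsum, map_mul, Equiv.Perm.sign_swap (ne_rev i)]
    rcases Int.units_eq_one_or (Equiv.Perm.sign σ) with h | h
    · simp only [h, if_true, one_mul] at ih ⊢
      rw [if_neg (by decide)]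
      obtain ⟨r, hr⟩ := ih
      exact ⟨r - u (σ i), by linarith⟩
    · simp only [h] at ih ⊢
      rw [if_neg (by decide)] at ih
      rw [if_pos (by decide)]
      obtain ⟨r, hr⟩ := ih
      exact ⟨r + c - u (σ i), by linarith⟩

lemma even_halfSum_comp_of_sign {n : ℕ} {σ : Equiv.Perm (Fin (2*n))} (hσ : inSh n σ)
    (hs : Equiv.Perm.sign σ = 1)
    {c : ℤ} {u : Fin (2*n) → ℤ} (hu : ∀ j, u j + u j.rev = c) :
    Even (halfSum n (fun j => u (σ j)) - halfSum n u) := by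
  simpa [hs] using even_halfSum_comp hσ hu

lemma sign_eq_one_of_even_halfSum {n : ℕ} {σ : Equiv.Perm (Fin (2*n))} (hσ : inSh n σ)
    {c : ℤ} (hc : Odd c) {u : Fin (2*n) → ℤ} (hu : ∀ j, u j + u j.rev = c)
    (h : Even (halfSum n (fun j => u (σ j)) - halfSum n u)) : Equiv.Perm.sign σ = 1 := by
  by_contra hs
  have h1 := even_halfSum_comp hσ hu
  rw [if_neg hs, mul_one] at h1
  have := h.sub h1
  rw [sub_sub_cancel] at this
  exact Int.not_even_iff_odd.2 hc this

/-- A totally isotropic `0/1`-vector. -/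
structure IsIso (n : ℕ) (e : Fin (2*n) → ℤ) : Prop where
  nonneg : ∀ j, 0 ≤ e j
  add_rev : ∀ j, e j + e j.rev = 1

lemma IsIso.eq_zero_or_one {n : ℕ} {e : Fin (2*n) → ℤ} (he : IsIso n e) (j : Fin (2*n)) :
    e j = 0 ∨ e j = 1 := by
  have h1 := he.nonneg j
  have h2 := he.nonneg j.rev
  have h3 := he.add_rev j
  omega

lemma isIso_mu {n : ℕ} {μ : Fin (2*n) → ℤ} (hμ : μ = mu1 n ∨ μ = mu2 n) : IsIso n μ := by
  constructor
  · intro j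
    rcases hμ with rfl | rfl <;> simp only [mu1, mu2] <;> split_ifs <;> simp
  · intro j
    have := j.isLt
    rcases hμ with rfl | rfl <;> simp only [mu1, mu2, Fin.val_rev] <;> split_ifs <;>
      first | rfl | omega

lemma exists_inW0_of_even {n : ℕ} {μ e : Fin (2*n) → ℤ} (hμ : IsIso n μ) (he : IsIso n e)
    (h : Even (halfSum n e - halfSum n μ)) : ∃ σ, inW0 n σ ∧ e = permAct n σ μ := by
  have hrev : ∀ j, e j = μ j ↔ e j.rev = μ j.rev := fun j => by
    have h1 := hμ.add_rev j
    have h2 := he.add_rev j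
    omega
  let f : Fin (2*n) → Fin (2*n) := fun i => if e i = μ i then i else i.rev
  have hf : Function.Involutive f := fun i => by
    by_cases hi : e i = μ i
    · simp [f, hi]
    · have hi' : ¬ e i.rev = μ i.rev := fun hc => hi ((hrev i).2 hc)
      simp [f, hi, hi']
  let τ : Equiv.Perm (Fin (2*n)) := hf.toPerm
  have hτ : ∀ i, τ i = if e i = μ i then i else i.rev := fun i => rfl
  have hSh : inSh n τ := fun i => by
    by_cases hi : e i = μ i
    · simp [hτ, hi, (hrev i).1 hi]
    · have hi' : ¬ e i.rev = μ i.rev := fun hc => hi ((hrev i).2 hc)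
      simp [hτ, hi, hi']
  have hcomp : e = fun j => μ (τ j) := by
    funext j
    rw [hτ]
    split_ifs with hj
    · exact hj
    · have h1 := hμ.add_rev j
      have h2 := hμ.eq_zero_or_one j
      have h3 := he.eq_zero_or_one j
      omega
  have hs : Equiv.Perm.sign τ = 1 :=
    sign_eq_one_of_even_halfSum hSh odd_one hμ.add_rev (by rwa [← hcomp])
  refine ⟨τ⁻¹, ⟨hSh.inv, by rw [Equiv.Perm.sign_inv, hs]⟩, ?_⟩
  rw [hcomp]
  funext j
  simp [permAct]

lemma isIso_permAct {n : ℕ} {μ : Fin (2*n) → ℤ} (hμ : IsIso n μ)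
    {σ : Equiv.Perm (Fin (2*n))} (hσ : inSh n σ) : IsIso n (permAct n σ μ) :=
  ⟨fun j => hμ.nonneg _, fun j => by
    simp only [permAct, hσ.inv j]
    exact hμ.add_rev _⟩

lemma even_of_inW0 {n : ℕ} {μ : Fin (2*n) → ℤ} (hμ : IsIso n μ)
    {σ : Equiv.Perm (Fin (2*n))} (hσ : inW0 n σ) :
    Even (halfSum n (permAct n σ μ) - halfSum n μ) :=
  even_halfSum_comp_of_sign hσ.1.inv (by rw [Equiv.Perm.sign_inv, hσ.2]) hμ.add_rev

/-- The orbit `W°μ`, in `ℝ^{2n}`. -/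
def orbitR (n : ℕ) (μ : Fin (2*n) → ℤ) : Set (Fin (2*n) → ℝ) :=
  {y | ∃ σ, inW0 n σ ∧ y = fun i => (permAct n σ μ i : ℝ)}

lemma cast_mem_orbitR {n : ℕ} {μ e : Fin (2*n) → ℤ} (hμ : IsIso n μ) (he : IsIso n e)
    (h : Even (halfSum n e - halfSum n μ)) : (fun i => (e i : ℝ)) ∈ orbitR n μ := by
  obtain ⟨σ, h1, h2⟩ := exists_inW0_of_even hμ he h
  exact ⟨σ, h1, by rw [h2]⟩

/-- A point of `Conv(W°μ)` has coordinates in `[0,1]`. -/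
lemma nonneg_of_mem_convexHull {n : ℕ} {μ : Fin (2*n) → ℤ} (hμ : IsIso n μ)
    {y : Fin (2*n) → ℝ} (hy : y ∈ convexHull ℝ (orbitR n μ)) (j : Fin (2*n)) : 0 ≤ y j := by
  have hconv : Convex ℝ {y : Fin (2*n) → ℝ | 0 ≤ y j} :=
    convex_halfSpace_ge (LinearMap.proj (R := ℝ) (φ := fun _ : Fin (2*n) => ℝ) j).isLinear 0
  refine convexHull_min ?_ hconv hy
  rintro _ ⟨σ, _, rfl⟩
  have h : 0 ≤ permAct n σ μ j := hμ.nonneg _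
  exact (Int.cast_nonneg h : (0:ℝ) ≤ (permAct n σ μ j : ℝ))

/-- A totally isotropic lattice point of `Conv(W°μ)` lies in the orbit `W°μ`. -/
lemma even_of_cast_mem_convexHull {n : ℕ} {μ e : Fin (2*n) → ℤ} (hμ : IsIso n μ)
    (he : IsIso n e) (hy : (fun i => (e i : ℝ)) ∈ convexHull ℝ (orbitR n μ)) :
    ∃ σ, inW0 n σ ∧ e = permAct n σ μ := by
  by_contra hne
  let L : (Fin (2*n) → ℝ) →ₗ[ℝ] ℝ :=
    ∑ j, (2 * (e j : ℝ) - 1) • LinearMap.proj (R := ℝ) (φ := fun _ : Fin (2*n) => ℝ) j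
  have hL : ∀ y, L y = ∑ j, (2 * (e j : ℝ) - 1) * y j := fun y => by
    simp [L, LinearMap.sum_apply]
  have hconv : Convex ℝ {y | L y ≤ (∑ j, (2 * (e j : ℝ) - 1) * e j) - 1} :=
    convex_halfSpace_le L.isLinear _
  have := convexHull_min ?_ hconv hy
  · rw [Set.mem_ofPred_eq, hL] at this
    linarith
  · rintro _ ⟨σ, hσ, rfl⟩
    have hf := isIso_permAct hμ hσ.1
    rw [Set.mem_ofPred_eq, hL]
    have hex : ∃ j, e j ≠ permAct n σ μ j := by
      by_contra! hall
      exact hne ⟨σ, hσ, funext hall⟩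
    obtain ⟨j, hj⟩ := hex
    have hterm : ∀ i, 0 ≤ (2 * e i - 1) * (e i - permAct n σ μ i) := fun i => by
      rcases he.eq_zero_or_one i with h1 | h1 <;>
      rcases hf.eq_zero_or_one i with h2 | h2 <;> rw [h1, h2] <;> norm_num
    have hle := Finset.single_le_sum (f := fun i => (2 * e i - 1) * (e i - permAct n σ μ i))
      (fun i _ => hterm i) (mem_univ j)
    have h1 : 1 ≤ (2 * e j - 1) * (e j - permAct n σ μ j) := by
      rcases he.eq_zero_or_one j with h1 | h1 <;>
      rcases hf.eq_zero_or_one j with h2 | h2 <;> simp_all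
    have h2 : (1:ℤ) ≤ ∑ i, (2 * e i - 1) * (e i - permAct n σ μ i) := h1.trans hle
    have h3 : (1:ℝ) ≤ ∑ i, (2 * (e i : ℝ) - 1) * (e i - permAct n σ μ i) := by
      exact_mod_cast h2
    simp only [mul_sub, Finset.sum_sub_distrib] at h3 ⊢
    linarith

lemma sum_mul_eq_of_antisymm {n : ℕ} (l D : Fin (2*n) → ℝ) (hD : ∀ j : Fin (2*n), D j.rev = - D j) :
    2 * ∑ j, l j * D j = ∑ j : Fin (2*n), (l j - l j.rev) * D j := by
  have h : ∑ j : Fin (2*n), l j.rev * D j.rev = ∑ j, l j * D j :=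
    Equiv.sum_comp Fin.revPerm (fun j => l j * D j)
  simp only [sub_mul, Finset.sum_sub_distrib]
  simp only [hD, mul_neg, Finset.sum_neg_distrib] at h
  linarith

lemma orbitR_finite {n : ℕ} (μ : Fin (2*n) → ℤ) : (orbitR n μ).Finite := by
  refine (Set.finite_range fun σ : Equiv.Perm (Fin (2*n)) =>
    fun i => (permAct n σ μ i : ℝ)).subset ?_
  rintro _ ⟨σ, _, rfl⟩
  exact ⟨σ, rfl⟩

/-- A point of the cube with two independent coordinates equal to `1/2` lies in `Conv(W°μ)`. -/
lemma mem_convexHull_of_half {n : ℕ} {μ : Fin (2*n) → ℤ} (hμ : IsIso n μ)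
    {y : Fin (2*n) → ℝ} (hy0 : ∀ j, 0 ≤ y j) (hy : ∀ j, y j + y j.rev = 1)
    {a b : Fin (2*n)} (ha : (a:ℕ) < n) (hb : (b:ℕ) < n) (hab : a ≠ b)
    (hya : y a = 1/2) (hyb : y b = 1/2) : y ∈ convexHull ℝ (orbitR n μ) := by
  by_contra hnot
  obtain ⟨f, r, hf1, hf2⟩ := geometric_hahn_banach_closed_point
    (convex_convexHull ℝ (orbitR n μ))
    ((orbitR_finite μ).isClosed_convexHull ℝ) hnot
  have hlin : ∀ z : Fin (2*n) → ℝ, f z = ∑ j, f (Pi.single j 1) * z j := fun z => by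
    have h := LinearMap.pi_apply_eq_sum_univ (f : (Fin (2*n) → ℝ) →ₗ[ℝ] ℝ) z
    have hs : ∀ i : Fin (2*n), (fun j => if i = j then (1:ℝ) else 0) = Pi.single i 1 :=
      fun i => by
        funext j
        simp [Pi.single_apply, eq_comm]
    simp only [hs, smul_eq_mul, ContinuousLinearMap.coe_coe] at h
    rw [h]
    exact Finset.sum_congr rfl fun j _ => mul_comm _ _
  set l : Fin (2*n) → ℝ := fun j => f (Pi.single j 1) with hl
  have hlt : ∀ e : Fin (2*n) → ℤ, IsIso n e → Even (halfSum n e - halfSum n μ) →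
      ∑ j, l j * e j < ∑ j, l j * y j := fun e he h => by
    rw [← hlin y, ← hlin fun j => (e j : ℝ)]
    exact (hf1 _ (subset_convexHull ℝ _ (cast_mem_orbitR hμ he h))).trans hf2
  let e : Fin (2*n) → ℤ := fun j =>
    if 0 < l j - l j.rev ∨ (l j - l j.rev = 0 ∧ (j:ℕ) < n) then 1 else 0
  have he : IsIso n e := by
    constructor
    · intro j
      simp only [e]
      split_ifs <;> simp
    · intro j
      have h3 := rev_lt_iff j
      simp only [e, Fin.rev_rev]
      rcases lt_trichotomy (l j - l j.rev) 0 with h | h | h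
      · rw [if_neg (by rintro (h' | ⟨h', _⟩) <;> linarith), if_pos (Or.inl (by linarith))]
        rfl
      · have h' : l j.rev - l j = 0 := by linarith
        simp only [h, h', h3]
        by_cases hj : (j:ℕ) < n <;> simp [hj]
      · rw [if_pos (Or.inl h), if_neg (by rintro (h' | ⟨h', _⟩) <;> linarith)]
        rfl
  have hterm : ∀ j, 0 ≤ (l j - l j.rev) * (e j - y j) := fun j => by
    have h1 := hy j
    have h2 := hy0 j.rev
    simp only [e]
    split_ifs with h
    · rcases h with h | h
      · push_cast
        exact mul_nonneg h.le (by linarith)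
      · rw [h.1, zero_mul]
    · push Not at h
      push_cast
      exact mul_nonneg_of_nonpos_of_nonpos h.1 (by linarith [hy0 j])
  by_cases hpar : Even (halfSum n e - halfSum n μ)
  · have h1 := hlt e he hpar
    have h2 := sum_mul_eq_of_antisymm l (fun j => (e j : ℝ) - y j) (fun j => by
      have h1 : (e j : ℝ) + e j.rev = 1 := by exact_mod_cast he.add_rev j
      linarith [hy j])
    have h3 := Finset.sum_nonneg fun j (_ : j ∈ univ) => hterm j
    simp only [mul_sub, Finset.sum_sub_distrib] at h1 h2 h3
    linarith
  · have hflip : ∀ i : Fin (2*n), IsIso n (fun j => e (Equiv.swap i i.rev j)) ∧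
        Even (halfSum n (fun j => e (Equiv.swap i i.rev j)) - halfSum n μ) := fun i => by
      refine ⟨⟨fun j => he.nonneg _, fun j => ?_⟩, ?_⟩
      · rw [inSh_swap_rev i j]
        exact he.add_rev _
      · have h1 := even_halfSum_comp (inSh_swap_rev i) he.add_rev
        rw [Equiv.Perm.sign_swap (ne_rev i), if_neg (by decide)] at h1
        rw [Int.not_even_iff_odd] at hpar
        have h2 := (h1.add_odd hpar).add_odd odd_one
        rwa [show ∀ a b c : ℤ, a - b - 1 * 1 + (b - c) + 1 = a - c from fun _ _ _ => by ring]
          at h2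
    have hA := hlt _ (hflip a).1 (hflip a).2
    have hB := hlt _ (hflip b).1 (hflip b).2
    have h2 := sum_mul_eq_of_antisymm l (fun j => ((e (Equiv.swap a a.rev j) : ℝ) - y j) +
      ((e (Equiv.swap b b.rev j) : ℝ) - y j)) (fun j => by
      have h1 : (e (Equiv.swap a a.rev j) : ℝ) + e (Equiv.swap a a.rev j.rev) = 1 := by
        exact_mod_cast (hflip a).1.add_rev j
      have h2 : (e (Equiv.swap b b.rev j) : ℝ) + e (Equiv.swap b b.rev j.rev) = 1 := by
        exact_mod_cast (hflip b).1.add_rev j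
      linarith [hy j])
    have hab' : a ≠ b.rev := by
      rintro rfl
      exact (rev_lt_iff b).1 ha hb
    have hab'' : a.rev ≠ b := fun h => hab' (by rw [← h, Fin.rev_rev])
    have hab3 : a.rev ≠ b.rev := fun h => hab (Fin.rev_injective h)
    have hear : (e a : ℝ) + e a.rev = 1 := by exact_mod_cast he.add_rev a
    have hebr : (e b : ℝ) + e b.rev = 1 := by exact_mod_cast he.add_rev b
    have h3 : 0 ≤ ∑ j, (l j - l j.rev) * (((e (Equiv.swap a a.rev j) : ℝ) - y j) +
        ((e (Equiv.swap b b.rev j) : ℝ) - y j)) := by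
      refine Finset.sum_nonneg fun j _ => ?_
      by_cases hja : j = a
      · subst hja
        rw [Equiv.swap_apply_left, Equiv.swap_apply_of_ne_of_ne hab hab']
        exact le_of_eq (by rw [hya]; linear_combination (-(l j - l j.rev)) * hear)
      by_cases hja' : j = a.rev
      · subst hja'
        rw [Equiv.swap_apply_right, Equiv.swap_apply_of_ne_of_ne hab'' hab3]
        have : y a.rev = 1/2 := by linarith [hy a]
        exact le_of_eq (by rw [this]; linear_combination (-(l a.rev - l a.rev.rev)) * hear)
      by_cases hjb : j = b
      · subst hjb
        rw [Equiv.swap_apply_left, Equiv.swap_apply_of_ne_of_ne hja hja']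
        exact le_of_eq (by rw [hyb]; linear_combination (-(l j - l j.rev)) * hebr)
      by_cases hjb' : j = b.rev
      · subst hjb'
        rw [Equiv.swap_apply_right, Equiv.swap_apply_of_ne_of_ne hja hja']
        have : y b.rev = 1/2 := by linarith [hy b]
        exact le_of_eq (by rw [this]; linear_combination (-(l b.rev - l b.rev.rev)) * hebr)
      rw [Equiv.swap_apply_of_ne_of_ne hja hja', Equiv.swap_apply_of_ne_of_ne hjb hjb', mul_add]
      exact add_nonneg (hterm j) (hterm j)
    simp only [mul_sub, mul_add, Finset.sum_sub_distrib, Finset.sum_add_distrib] at h2 h3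
    linarith

lemma om_add_rev {n : ℕ} (j : Fin (2*n)) : om n n j + om n n j.rev = -1 := by
  have h := rev_lt_iff j
  simp only [om]
  split_ifs <;> first | rfl | omega

/-- The midpoint of `ω_k` and `ω_{-k}`. -/
noncomputable def alcVertex (n k : ℕ) : Fin (2*n) → ℝ :=
  fun j => ((om n k j : ℝ) - om n k j.rev) / 2

lemma alcVertex_rev {n k : ℕ} (j : Fin (2*n)) : alcVertex n k j.rev = - alcVertex n k j := by
  simp only [alcVertex, Fin.rev_rev]
  ring

lemma alcVertex_of_lt {n k : ℕ} (hk : k ≤ n) {j : Fin (2*n)} (hj : (j:ℕ) < n) :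
    alcVertex n k j = if (j:ℕ) < k then -1/2 else 0 := by
  have h : ¬ ((j.rev : Fin (2*n)) : ℕ) < k := by
    rw [Fin.val_rev]
    omega
  simp only [alcVertex, om, if_neg h]
  split_ifs <;> norm_num

lemma alcVertex_mem_ClA {n k : ℕ} (hk : k ≤ n) : alcVertex n k ∈ ClA n := by
  refine ⟨fun i j => by rw [alcVertex_rev, alcVertex_rev]; ring, fun i j hij hj => ?_⟩
  have hij' : (i:ℕ) < j := hij
  rw [alcVertex_rev, alcVertex_of_lt hk hj, alcVertex_of_lt hk (hij'.trans hj)]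
  split_ifs <;> first | omega | norm_num

/-- The point `(-1, 0, …, 0, 1)`. -/
def vertexFirst (n : ℕ) : Fin (2*n) → ℤ :=
  fun j => if (j:ℕ) = 0 then -1 else if (j:ℕ) = 2*n-1 then 1 else 0

/-- The point `((-1)^{(n-1)}, 0, -1, 0^{(n-1)})`. -/
def vertexLast (n : ℕ) : Fin (2*n) → ℤ :=
  fun j => if (j:ℕ) < n - 1 ∨ (j:ℕ) = n then -1 else 0

lemma vertexFirst_add_rev {n : ℕ} (j : Fin (2*n)) :
    vertexFirst n j + vertexFirst n j.rev = 0 := by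
  have := j.isLt
  simp only [vertexFirst, Fin.val_rev]
  split_ifs <;> first | rfl | omega

lemma vertexLast_add_rev {n : ℕ} (j : Fin (2*n)) :
    vertexLast n j + vertexLast n j.rev = -1 := by
  have := j.isLt
  simp only [vertexLast, Fin.val_rev]
  split_ifs <;> first | rfl | omega

lemma sum_range_ite_sub (Y : ℕ → ℝ) {j m : ℕ} (h : j ≤ m) :
    ∑ k ∈ Finset.range m, (if j ≤ k then Y (k+1) - Y k else 0) = Y m - Y j := by
  induction m, h using Nat.le_induction with
  | base =>
    rw [sub_self]
    exact Finset.sum_eq_zero fun k hk => if_neg (by rw [Finset.mem_range] at hk; omega)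
  | succ m hm ih =>
    rw [Finset.sum_range_succ, ih, if_pos hm]
    ring

/-- The closed alcove is contained in any shift-invariant convex set containing its vertices. -/
lemma ClA_subset {n : ℕ} (hn : 2 ≤ n) {S : Set (Fin (2*n) → ℝ)} (hS : Convex ℝ S)
    (hshift : ∀ x ∈ S, ∀ t : ℝ, (fun j => x j + t) ∈ S)
    (ha : ∀ k ≤ n, alcVertex n k ∈ S) (hfirst : (fun j => (vertexFirst n j : ℝ)) ∈ S)
    (hlast : (fun j => (vertexLast n j : ℝ)) ∈ S) : ClA n ⊆ S := by
  rintro x ⟨hx1, hx2⟩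
  let i0 : Fin (2*n) := ⟨0, by omega⟩
  let il : Fin (2*n) := ⟨n-1, by omega⟩
  obtain ⟨t, ht⟩ : ∃ t : ℝ, ∀ j, x j + x j.rev = 2 * t :=
    ⟨(x i0 + x i0.rev) / 2, fun j => by rw [hx1 j i0]; ring⟩
  let Y : ℕ → ℝ := fun k => if k = 0 then |x i0 - t + 1/2| - 1/2
    else if k = n - 1 then -|x il - t| else if h : k < 2 * n then x ⟨k, h⟩ - t else 0
  have hY0 : Y 0 = |x i0 - t + 1/2| - 1/2 := rfl
  have hYl : Y (n-1) = -|x il - t| := by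
    simp only [Y]
    rw [if_neg (by omega), if_pos trivial]
  have hY : ∀ j : Fin (2*n), (j:ℕ) ≠ 0 → (j:ℕ) ≠ n - 1 → Y j = x j - t := fun j h1 h2 => by
    simp only [Y]
    rw [if_neg h1, if_neg h2, dif_pos j.isLt]
  have hmono : ∀ k, k < n - 1 → Y k ≤ Y (k+1) := fun k hk => by
    have hk1 : k < 2 * n := by omega
    have hk2 : k + 1 < 2 * n := by omega
    obtain ⟨h1, h2, h3, h4⟩ := hx2 ⟨k, hk1⟩ ⟨k+1, hk2⟩ (by simp) (by simp; omega)
    rw [ht] at h3 h4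
    by_cases hk0 : k = 0
    · subst hk0
      rw [hY0]
      change -1 ≤ x i0 - _ at h1
      change x i0 - _ ≤ 0 at h2
      change -1 ≤ x i0 + _ - _ at h3
      change x i0 + _ - _ ≤ 0 at h4
      by_cases hkl : 0 + 1 = n - 1
      · have hil : (⟨0 + 1, hk2⟩ : Fin (2*n)) = il := Fin.ext hkl
        rw [hil] at h1 h2 h3 h4
        rw [hkl, hYl]
        rcases abs_cases (x i0 - t + 1/2) with h5 | h5 <;>
        rcases abs_cases (x il - t) with h6 | h6 <;> linarith [h5.1, h6.1]
      · have h5 := hY ⟨0 + 1, hk2⟩ (by simp) hkl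
        change Y (0 + 1) = _ at h5
        rw [h5]
        rcases abs_cases (x i0 - t + 1/2) with h5 | h5 <;> linarith [h5.1]
    · have h5 := hY ⟨k, hk1⟩ hk0 (by simp; omega)
      change Y k = _ at h5
      rw [h5]
      by_cases hkl : k + 1 = n - 1
      · have hil : (⟨k + 1, hk2⟩ : Fin (2*n)) = il := Fin.ext hkl
        rw [hil] at h1 h2 h3 h4
        rw [hkl, hYl]
        rcases abs_cases (x il - t) with h6 | h6 <;> linarith [h6.1]
      · have h6 := hY ⟨k + 1, hk2⟩ (by simp) hkl
        change Y (k + 1) = _ at h6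
        rw [h6]
        linarith
  have hYl0 : Y (n-1) ≤ 0 := by rw [hYl]; linarith [abs_nonneg (x il - t)]
  have hY00 : 0 ≤ 2 * Y 0 + 1 := by rw [hY0]; linarith [abs_nonneg (x i0 - t + 1/2)]
  obtain ⟨z0, hz0S, hz0r, hz0, hz0'⟩ : ∃ z ∈ S, (∀ j : Fin (2*n), z j.rev = - z j) ∧
      (∀ j : Fin (2*n), (j:ℕ) ≠ 0 → (j:ℕ) < n → z j = 0) ∧
      Y 0 + (2 * Y 0 + 1) * z i0 = x i0 - t := by
    by_cases h : 0 ≤ x i0 - t + 1/2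
    · refine ⟨_, ha 0 (by omega), fun j => alcVertex_rev j, fun j _ hj => ?_, ?_⟩
      · rw [alcVertex_of_lt (by omega) hj, if_neg (by omega)]
      · rw [alcVertex_of_lt (by omega) (by simp [i0]; omega), if_neg (by omega), hY0,
          abs_of_nonneg h]
        ring
    · refine ⟨_, hfirst, fun j => ?_, fun j h1 h2 => ?_, ?_⟩
      · have := vertexFirst_add_rev j
        rw [eq_neg_iff_add_eq_zero, add_comm]
        exact_mod_cast this
      · simp only [vertexFirst, if_neg h1]
        rw [if_neg (by omega)]
        simp
      · rw [hY0, abs_of_neg (by linarith)]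
        simp [vertexFirst, i0]
        ring
  obtain ⟨zl, hzlS, hzlr, hzl, hzl'⟩ : ∃ z ∈ S, (∀ j : Fin (2*n), z j.rev = - z j) ∧
      (∀ j : Fin (2*n), (j:ℕ) < n - 1 → z j = -1/2) ∧
      -2 * Y (n-1) * z il = x il - t := by
    have hil : (il : ℕ) < n := by simp only [il]; omega
    by_cases h : x il - t ≤ 0
    · refine ⟨_, ha n le_rfl, fun j => alcVertex_rev j, fun j hj => ?_, ?_⟩
      · rw [alcVertex_of_lt le_rfl (by omega), if_pos (by omega)]
      · rw [alcVertex_of_lt le_rfl hil, if_pos hil, hYl, abs_of_nonpos h]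
        ring
    · refine ⟨_, hshift _ hlast (1/2), fun j => ?_, fun j h1 => ?_, ?_⟩
      · have h1 := vertexLast_add_rev j
        have h2 : (vertexLast n j : ℝ) + vertexLast n j.rev = -1 := by exact_mod_cast h1
        linarith
      · simp only [vertexLast, if_pos (Or.inl h1)]
        norm_num
      · have h1 : vertexLast n il = 0 := by
          simp only [vertexLast, il]
          rw [if_neg (by omega)]
        rw [hYl, abs_of_pos (by linarith), h1]
        push_cast
        ring
  let wt : Option (Option (Fin (n-1))) → ℝ := fun o => o.elim (2 * Y 0 + 1) fun o =>
    o.elim (-2 * Y (n-1)) fun k => 2 * (Y (k+1) - Y k)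
  let pt : Option (Option (Fin (n-1))) → (Fin (2*n) → ℝ) := fun o => o.elim z0 fun o =>
    o.elim zl fun k => alcVertex n (k+1)
  have hsumY : ∑ k : Fin (n-1), 2 * (Y (k+1) - Y k) = 2 * (Y (n-1) - Y 0) := by
    rw [← Finset.mul_sum, Fin.sum_univ_eq_sum_range (fun k => Y (k+1) - Y k),
      Finset.sum_range_sub]
  have hmem : ∑ o, wt o • pt o ∈ S := by
    refine hS.sum_mem ?_ ?_ ?_
    · rintro (_ | _ | k) _
      · exact hY00
      · change 0 ≤ -2 * Y (n-1)
        linarith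
      · have := hmono k k.isLt
        change 0 ≤ 2 * (Y (k+1) - Y k)
        linarith
    · rw [Fintype.sum_option, Fintype.sum_option]
      change 2 * Y 0 + 1 + (-2 * Y (n-1) + ∑ k : Fin (n-1), 2 * (Y (k+1) - Y k)) = 1
      rw [hsumY]
      ring
    · rintro (_ | _ | k) _
      · exact hz0S
      · exact hzlS
      · exact ha _ (by omega)
  have hval : ∀ j, (∑ o, wt o • pt o) j = (2 * Y 0 + 1) * z0 j + (-2 * Y (n-1) * zl j +
      ∑ k : Fin (n-1), 2 * (Y (k+1) - Y k) * alcVertex n (k+1) j) := fun j => by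
    rw [Fintype.sum_option, Fintype.sum_option]
    simp [wt, pt]
  have hlow : ∀ j : Fin (2*n), (j:ℕ) < n → (∑ o, wt o • pt o) j = x j - t := fun j hj => by
    rw [hval]
    have h1 : ∑ k : Fin (n-1), 2 * (Y (k+1) - Y k) * alcVertex n (k+1) j =
        -(Y (n-1) - Y j) := by
      rw [← sum_range_ite_sub Y (show (j:ℕ) ≤ n - 1 by omega),
        ← Fin.sum_univ_eq_sum_range (fun k => if (j:ℕ) ≤ k then Y (k+1) - Y k else 0),
        ← Finset.sum_neg_distrib]
      refine Finset.sum_congr rfl fun k _ => ?_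
      rw [alcVertex_of_lt (by omega) hj]
      by_cases hjk : (j:ℕ) ≤ k
      · rw [if_pos hjk, if_pos (by omega)]; ring
      · rw [if_neg hjk, if_neg (by omega)]; ring
    rw [h1]
    by_cases hj0 : (j:ℕ) = 0
    · obtain rfl : j = i0 := Fin.ext hj0
      rw [hzl _ (by simp only [i0]; omega)]
      change _ + (_ + -(Y (n-1) - Y 0)) = _
      linarith
    · rw [hz0 j hj0 hj]
      by_cases hjl : (j:ℕ) = n - 1
      · obtain rfl : j = il := Fin.ext hjl
        change _ + (_ + -(Y (n-1) - Y (n-1))) = _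
        linarith
      · rw [hzl j (by omega), hY j hj0 hjl]
        ring
  have hrev : ∀ j : Fin (2*n), (∑ o, wt o • pt o) j.rev = - (∑ o, wt o • pt o) j := fun j => by
    simp only [hval, hz0r, hzlr, alcVertex_rev, mul_neg, Finset.sum_neg_distrib]
    ring
  have hall : x = fun j => (∑ o, wt o • pt o) j + t := by
    funext j
    by_cases hj : (j:ℕ) < n
    · rw [hlow j hj]; ring
    · have h1 := hlow j.rev ((rev_lt_iff j).2 hj)
      rw [hrev] at h1
      linarith [ht j]
  rw [hall]
  exact hshift _ hmem t

/-- An interior point of the alcove with strictly increasing coordinates. -/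
noncomputable def increasingPoint (n : ℕ) : Fin (2*n) → ℝ :=
  fun j => (2 * (j:ℝ) + 1 - 2 * n) * (1 / (8 * n))

lemma increasingPoint_mem_ClA {n : ℕ} (hn : 0 < n) : increasingPoint n ∈ ClA n := by
  have hn' : (0:ℝ) < n := by exact_mod_cast hn
  have hr : (0:ℝ) < 1 / (8 * n) := by positivity
  have hrn : 2 * (n:ℝ) * (1 / (8 * n)) = 1 / 4 := by field_simp; norm_num
  have hrev : ∀ j : Fin (2*n), increasingPoint n j + increasingPoint n j.rev = 0 := fun j => by
    have h : ((j.rev : Fin (2*n)) : ℝ) + j + 1 = 2 * n := by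
      have h := j.isLt
      have h2 := Fin.val_rev j
      have h3 : ((j.rev : Fin (2*n)) : ℕ) + j + 1 = 2 * n := by omega
      exact_mod_cast h3
    simp only [increasingPoint, ← add_mul]
    rw [show 2 * (j:ℝ) + 1 - 2 * n + (2 * ((j.rev : Fin (2*n)) : ℝ) + 1 - 2 * n) = 0 by linarith,
      zero_mul]
  have hbound : ∀ j : Fin (2*n), (j:ℕ) < n →
      -1/4 ≤ increasingPoint n j ∧ increasingPoint n j ≤ 0 := fun j hj => by
    have hj' : (j:ℝ) + 1 ≤ n := by exact_mod_cast hj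
    have hj0 : (0:ℝ) ≤ (j:ℝ) := Nat.cast_nonneg _
    constructor
    · have h := mul_le_mul_of_nonneg_right
        (show -(2 * (n:ℝ)) ≤ 2 * (j:ℝ) + 1 - 2 * n by linarith) hr.le
      simp only [increasingPoint]
      linarith
    · exact mul_nonpos_of_nonpos_of_nonneg (by linarith) hr.le
  refine ⟨fun i j => by rw [hrev, hrev], fun i j hij hj => ?_⟩
  have hij' : (i:ℕ) < j := hij
  have h1 := hbound i (hij'.trans hj)
  have h2 := hbound j hj
  have h3 : increasingPoint n i ≤ increasingPoint n j := by
    have h : (i:ℝ) ≤ (j:ℝ) := by exact_mod_cast hij'.le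
    exact mul_le_mul_of_nonneg_right (by linarith) hr.le
  rw [hrev]
  refine ⟨?_, ?_, ?_, ?_⟩ <;> linarith [h1.1, h1.2, h2.1, h2.2]

lemma increasingPoint_lt {n : ℕ} {i j : Fin (2*n)} (h : i < j) :
    increasingPoint n i < increasingPoint n j := by
  have hn : (0:ℝ) < n := by
    have : 0 < n := by have := i.isLt; omega
    exact_mod_cast this
  have h' : (i:ℝ) < (j:ℝ) := by exact_mod_cast h
  exact mul_lt_mul_of_pos_right (by linarith) (by positivity)

/-- The displacement `wx - x` as a function of `x`. -/
def displacement (n : ℕ) (w : Wt n) (x : Fin (2*n) → ℝ) : Fin (2*n) → ℝ :=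
  fun i => wactR n w x i - x i

lemma convex_preimage_displacement {n : ℕ} (w : Wt n) {C : Set (Fin (2*n) → ℝ)}
    (hC : Convex ℝ C) : Convex ℝ {x | displacement n w x ∈ C} := by
  intro x hx y hy a b ha hb hab
  have h := hC hx hy ha hb hab
  have he : displacement n w (a • x + b • y) =
      a • displacement n w x + b • displacement n w y := by
    funext i
    simp only [displacement, wactR, Pi.add_apply, Pi.smul_apply, smul_eq_mul]
    linear_combination (-(w.1 i : ℝ)) * hab
  exact (congrArg (· ∈ C) he).mpr h

lemma displacement_add_const {n : ℕ} (w : Wt n) (x : Fin (2*n) → ℝ) (t : ℝ) :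
    displacement n w (fun j => x j + t) = displacement n w x := by
  funext i
  simp only [displacement, wactR]
  ring

lemma muk_apply {n : ℕ} (w : Wt n) (k : ℕ) (j : Fin (2*n)) :
    muk n w k j = w.1 j + om n k (w.2⁻¹ j) - om n k j := rfl

lemma muk_zero {n : ℕ} (w : Wt n) : muk n w 0 = w.1 := by
  funext j
  simp [muk_apply, om]

lemma displacement_alcVertex {n : ℕ} {w : Wt n} (hσ : inSh n w.2)
    (hv : ∀ j, w.1 j + w.1 j.rev = 1) (k : ℕ) (j : Fin (2*n)) :
    displacement n w (alcVertex n k) j = ((muk n w k j : ℝ) + 1 - muk n w k j.rev) / 2 := by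
  have h : (w.1 j : ℝ) + w.1 j.rev = 1 := by exact_mod_cast hv j
  simp only [displacement, wactR, muk_apply, alcVertex, hσ.inv j]
  push_cast
  linarith

lemma displacement_alcVertex_of_totIso {n : ℕ} {w : Wt n} (hσ : inSh n w.2)
    (hv : ∀ j, w.1 j + w.1 j.rev = 1) {k : ℕ} (hk : TotIso n (muk n w k)) :
    displacement n w (alcVertex n k) = fun j => (muk n w k j : ℝ) := by
  funext j
  have h : (muk n w k j : ℝ) + muk n w k j.rev = 1 := by exact_mod_cast hk j
  rw [displacement_alcVertex hσ hv]
  linarith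

lemma sum_eq_of_add_rev {n : ℕ} {u : Fin (2*n) → ℤ} {c : ℤ} (h : ∀ j, u j + u j.rev = c) :
    ∑ j, u j = n * c := by
  have h1 : ∑ j : Fin (2*n), u j.rev = ∑ j, u j := Equiv.sum_comp Fin.revPerm u
  have h2 : ∑ j : Fin (2*n), (u j + u j.rev) = 2 * n * c := by
    simp [h]
  rw [Finset.sum_add_distrib, h1] at h2
  linarith

lemma permissible_of_spinPerm {n : ℕ} (hn : 2 ≤ n) {μ : Fin (2*n) → ℤ} (hμ : IsIso n μ)
    {w : Wt n} (hw : inWt n w) (h : SpinPerm n μ w) : PermKR n μ w := by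
  obtain ⟨⟨hsum, hGL⟩, hspin⟩ := h
  obtain ⟨hX, hσ⟩ := hw
  have hπ := hσ.inv
  have hv : ∀ j, w.1 j + w.1 j.rev = 1 := by
    intro j
    have h1 := sum_eq_of_add_rev (u := w.1) (fun i => hX i j)
    have h2 : ∑ j, valc n w 0 j = ∑ j, w.1 j := by simp [valc, wact, om]
    rw [← h2, hsum] at h1
    have hn0 : (n:ℤ) ≠ 0 := by exact_mod_cast (by omega : n ≠ 0)
    exact (mul_left_cancel₀ hn0 (by rw [mul_one]; exact h1)).symm
  have hmuk : ∀ k < 2*n, ∀ j, 0 ≤ muk n w k j ∧ muk n w k j ≤ 1 := fun k hk j => by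
    have := hGL k hk j
    simp only [muk]
    omega
  have hviso : IsIso n w.1 := ⟨fun j => by
    have := (hmuk 0 (by omega) j).1
    rwa [muk_zero] at this, hv⟩
  have hparity : ∀ k ≤ n, TotIso n (muk n w k) →
      Even (halfSum n (muk n w k) - halfSum n μ) := fun k hk hiso => by
    obtain ⟨σ, h1, h2⟩ := hspin k hk hiso
    rw [h2]
    exact even_of_inW0 hμ h1
  have hvpar : Even (halfSum n w.1 - halfSum n μ) := by
    have := hparity 0 (by omega) (by rw [muk_zero]; exact hv)
    rwa [muk_zero] at this
  have hniso : IsIso n (muk n w n) := ⟨fun j => (hmuk n (by omega) j).1, fun j => by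
    have h1 := om_add_rev j
    have h2 := om_add_rev (w.2⁻¹ j)
    have h3 := hv j
    simp only [muk_apply, hπ j]
    linarith⟩
  have hnpar := hparity n le_rfl hniso.add_rev
  have hsub : ∀ u : Fin (2*n) → ℤ, halfSum n (fun j => w.1 j + u (w.2⁻¹ j) - u j) =
      halfSum n w.1 + (halfSum n (fun j => u (w.2⁻¹ j)) - halfSum n u) := fun u => by
    simp only [halfSum, Finset.sum_add_distrib, Finset.sum_sub_distrib]
    ring
  have hsign : Equiv.Perm.sign w.2⁻¹ = 1 := by
    refine sign_eq_one_of_even_halfSum hπ (by decide) om_add_rev ?_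
    have h1 : halfSum n (muk n w n) = _ := hsub (om n n)
    rw [h1] at hnpar
    have h2 := hnpar.sub hvpar
    rwa [show ∀ a b c : ℤ, a + b - c - (a - c) = b from fun _ _ _ => by ring] at h2
  have hlow : ∀ j, w.1 j = 0 → (j:ℕ) ≤ (w.2⁻¹ j : Fin (2*n)) := fun j hj => by
    by_contra hc
    have h1 := (hmuk j j.isLt j).1
    rw [muk_apply, hj] at h1
    simp only [om] at h1
    rw [if_pos (by omega), if_neg (by omega)] at h1
    omega
  have hup : ∀ j, w.1 j = 1 → ((w.2⁻¹ j : Fin (2*n)) : ℕ) ≤ j := fun j hj => by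
    have h1 := hlow j.rev (by have := hv j; omega)
    rw [hπ j, Fin.val_rev, Fin.val_rev] at h1
    have := (w.2⁻¹ j).isLt
    omega
  have hno : ∀ k ≤ n, ∀ (e : Fin (2*n) → ℤ) (i : Fin (2*n)), IsIso n e →
      Even (halfSum n e - halfSum n μ) →
      muk n w k ≠ fun j => e (Equiv.swap i i.rev j) := fun k hk e i he hpar heq => by
    have h1 := hparity k hk (by
      rw [heq]
      intro j
      simp only [inSh_swap_rev i j]
      exact he.add_rev _)
    rw [heq] at h1
    have h2 := h1.sub hpar
    rw [sub_sub_sub_cancel_right] at h2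
    have h3 := sign_eq_one_of_even_halfSum (inSh_swap_rev i) odd_one he.add_rev h2
    rw [Equiv.Perm.sign_swap (ne_rev i)] at h3
    exact absurd h3 (by decide)
  have hvert : ∀ (u : Fin (2*n) → ℤ) (c : ℤ), (∀ j, u j + u j.rev = c) →
      (∀ j, 0 ≤ w.1 j + u (w.2⁻¹ j) - u j) →
      displacement n w (fun j => (u j : ℝ)) ∈ convexHull ℝ (orbitR n μ) := fun u c hu h0 => by
    have he : IsIso n (fun j => w.1 j + u (w.2⁻¹ j) - u j) := ⟨h0, fun j => by
      have h1 := hu j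
      have h2 := hu (w.2⁻¹ j)
      have h3 := hv j
      simp only [hπ j]
      linarith⟩
    have hpar : Even (halfSum n (fun j => w.1 j + u (w.2⁻¹ j) - u j) - halfSum n μ) := by
      have h1 := hvpar.add (even_halfSum_comp_of_sign hπ hsign hu)
      rw [hsub]
      rwa [sub_add_eq_add_sub] at h1
    have hm := subset_convexHull ℝ _ (cast_mem_orbitR hμ he hpar)
    have heq : displacement n w (fun j => (u j : ℝ)) =
        fun j => ((w.1 j + u (w.2⁻¹ j) - u j : ℤ) : ℝ) := by
      funext j
      simp [displacement, wactR]
    rw [heq]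
    exact hm
  refine ⟨⟨(fun i => w.1 i - μ i, w.2), ⟨⟨fun i j => ?_, fun i => ?_, ?_⟩, hσ, ?_⟩, ?_⟩, ?_⟩
  · have h1 := hv i
    have h2 := hv j
    have h3 := hμ.add_rev i
    have h4 := hμ.add_rev j
    simp only
    linarith
  · have h1 := hv i
    have h2 := hμ.add_rev i
    simp only
    linarith
  · simpa [halfSum] using hvpar
  · rwa [Equiv.Perm.sign_inv] at hsign
  · ext i <;> simp [wmul, wtrans]
  · have hsubset : ClA n ⊆ {x | displacement n w x ∈ convexHull ℝ (orbitR n μ)} := by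
      refine ClA_subset hn (convex_preimage_displacement w (convex_convexHull ℝ _))
        (fun x hx t => ?_) (fun k hk => ?_) (hvert _ 0 vertexFirst_add_rev fun j => ?_)
        (hvert _ (-1) vertexLast_add_rev fun j => ?_)
      · rw [Set.mem_ofPred_eq, displacement_add_const]
        exact hx
      · rw [Set.mem_ofPred_eq]
        by_cases hiso : TotIso n (muk n w k)
        · rw [displacement_alcVertex_of_totIso hσ hv hiso]
          obtain ⟨σ, h1, h2⟩ := hspin k hk hiso
          exact subset_convexHull ℝ _ ⟨σ, h1, by rw [h2]⟩
        · have hbd := hmuk k (by omega)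
          have hsum0 : ∑ j : Fin (2*n), (muk n w k j + muk n w k j.rev - 1) = 0 := by
            have h1 : ∑ j : Fin (2*n), muk n w k j.rev = ∑ j, muk n w k j :=
              Equiv.sum_comp Fin.revPerm (muk n w k)
            have h2 : ∑ j, muk n w k j = n := by
              simp only [muk_apply, Finset.sum_add_distrib, Finset.sum_sub_distrib]
              rw [Equiv.sum_comp w.2⁻¹ (om n k), sum_eq_of_add_rev hv]
              ring
            rw [Finset.sum_sub_distrib, Finset.sum_add_distrib, h1, h2]
            simp
            ring
          obtain ⟨j0, hj0⟩ : ∃ j, muk n w k j + muk n w k j.rev ≠ 1 := by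
            simpa [TotIso] using hiso
          obtain ⟨a, -, ha⟩ := Finset.exists_pos_of_sum_zero_of_exists_nonzero _ hsum0
            ⟨j0, mem_univ _, fun h => hj0 (by linarith)⟩
          obtain ⟨b, -, hb⟩ := Finset.exists_pos_of_sum_zero_of_exists_nonzero
            (fun j : Fin (2*n) => -(muk n w k j + muk n w k j.rev - 1))
            (by rw [Finset.sum_neg_distrib, hsum0, neg_zero])
            ⟨j0, mem_univ _, fun h => hj0 (by linarith)⟩
          have hhalf : ∀ P : ℤ → Prop, (∃ j : Fin (2*n), P (muk n w k j + muk n w k j.rev)) →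
              ∃ j : Fin (2*n), (j:ℕ) < n ∧ P (muk n w k j + muk n w k j.rev) := by
            rintro P ⟨j, hj⟩
            by_cases hjn : (j:ℕ) < n
            · exact ⟨j, hjn, hj⟩
            · refine ⟨j.rev, (rev_lt_iff j).2 hjn, ?_⟩
              rwa [Fin.rev_rev, add_comm]
          obtain ⟨a, han, ha⟩ := hhalf (fun m => 0 < m - 1) ⟨a, ha⟩
          obtain ⟨b, hbn, hb⟩ := hhalf (fun m => 0 < -(m - 1)) ⟨b, hb⟩
          have hdisp := displacement_alcVertex hσ hv k
          have heqhalf : ∀ j, muk n w k j = muk n w k j.rev →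
              displacement n w (alcVertex n k) j = 1/2 := fun j hj => by
            rw [hdisp, hj]
            ring
          refine mem_convexHull_of_half hμ (fun j => ?_) (fun j => ?_) han hbn ?_
            (heqhalf a ?_) (heqhalf b ?_)
          · have h1 : (0:ℝ) ≤ muk n w k j := by exact_mod_cast (hbd j).1
            have h2 : (muk n w k j.rev : ℝ) ≤ 1 := by exact_mod_cast (hbd j.rev).2
            rw [hdisp]
            linarith
          · rw [hdisp, hdisp, Fin.rev_rev]
            ring
          · rintro rfl
            omega
          · have h1 := hbd a
            have h2 := hbd a.rev
            omega
          · have h1 := hbd b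
            have h2 := hbd b.rev
            omega
      · by_contra hneg
        have h1 := hviso.eq_zero_or_one j
        have h2 := hlow j
        have h3 := hup j
        have h4 := j.isLt
        have h5 := (w.2⁻¹ j).isLt
        have hbad : w.1 j = 1 ∧ (j:ℕ) = 2*n-1 ∧ ((w.2⁻¹ j : Fin (2*n)) : ℕ) = 0 := by
          simp only [vertexFirst] at hneg
          split_ifs at hneg <;> omega
        obtain ⟨hb1, hb2, hb3⟩ := hbad
        refine hno 1 (by omega) w.1 j hviso hvpar ?_
        have hjr : w.2⁻¹ j = j.rev := Fin.ext (by rw [hb3, Fin.val_rev]; omega)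
        have hjr' : w.2⁻¹ j.rev = j := by rw [hπ, hjr, Fin.rev_rev]
        funext i
        have hvj := hv j
        rw [muk_apply]
        by_cases hij : i = j
        · subst hij
          rw [Equiv.swap_apply_left]
          simp only [om]
          rw [if_pos (by omega), if_neg (by omega)]
          omega
        by_cases hij' : i = j.rev
        · subst hij'
          rw [Equiv.swap_apply_right, hjr']
          simp only [om, Fin.val_rev]
          rw [if_neg (by omega), if_pos (by omega)]
          omega
        · rw [Equiv.swap_apply_of_ne_of_ne hij hij']
          have h6 : ¬ ((w.2⁻¹ i : Fin (2*n)) : ℕ) < 1 := fun hc => hij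
            (w.2⁻¹.injective (Fin.ext (by omega)))
          have h7 : ¬ (i : ℕ) < 1 := fun hc => hij' (Fin.ext (by rw [Fin.val_rev]; omega))
          simp only [om, if_neg h6, if_neg h7]
          ring
      · by_contra hneg
        have h1 := hviso.eq_zero_or_one j
        have h2 := hlow j
        have h3 := hup j
        have h4 := j.isLt
        have h5 := (w.2⁻¹ j).isLt
        have hbad : w.1 j = 0 ∧ (j:ℕ) = n-1 ∧ ((w.2⁻¹ j : Fin (2*n)) : ℕ) = n := by
          simp only [vertexLast] at hneg
          split_ifs at hneg <;> omega
        obtain ⟨hb1, hb2, hb3⟩ := hbad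
        refine hno (n-1) (by omega) _ j hniso hnpar ?_
        have hjr : w.2⁻¹ j = j.rev := Fin.ext (by rw [hb3, Fin.val_rev]; omega)
        have hjr' : w.2⁻¹ j.rev = j := by rw [hπ, hjr, Fin.rev_rev]
        funext i
        have hvj := hv j
        by_cases hij : i = j
        · subst hij
          rw [Equiv.swap_apply_left, muk_apply, muk_apply, hjr']
          simp only [om, Fin.val_rev]
          rw [if_neg (by omega), if_neg (by omega), if_pos (by omega), if_neg (by omega)]
          omega
        by_cases hij' : i = j.rev
        · subst hij'
          rw [Equiv.swap_apply_right, muk_apply, muk_apply, hjr']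
          simp only [om, Fin.val_rev]
          rw [if_neg (by omega), if_neg (by omega), if_neg (by omega), if_pos (by omega)]
          omega
        · rw [Equiv.swap_apply_of_ne_of_ne hij hij', muk_apply, muk_apply]
          have h6 : ((w.2⁻¹ i : Fin (2*n)) : ℕ) ≠ n - 1 := fun hc => hij'
            (w.2⁻¹.injective (Fin.ext (by rw [hjr']; omega)))
          have h7 : (i : ℕ) ≠ n - 1 := fun hc => hij (Fin.ext (by omega))
          have h8 : ∀ m : ℕ, m ≠ n - 1 → (m < n - 1 ↔ m < n) := fun m hm => by omega
          simp only [om, h8 _ h6, h8 _ h7]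
    exact fun x hx => hsubset hx

lemma spinPerm_of_permissible {n : ℕ} (hn : 2 ≤ n) {μ : Fin (2*n) → ℤ} (hμ : IsIso n μ)
    {w : Wt n} (hw : inWt n w) (h : PermKR n μ w) : SpinPerm n μ w := by
  obtain ⟨⟨x, ⟨hx1, -⟩, hwx⟩, hconv⟩ := h
  replace hconv : ∀ x ∈ ClA n, displacement n w x ∈ convexHull ℝ (orbitR n μ) := hconv
  have hσ := hw.2
  have hπ := hσ.inv
  have hv : ∀ j, w.1 j + w.1 j.rev = 1 := fun j => by
    have h1 := hx1.2.1 j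
    have h2 := hμ.add_rev j
    simp only [hwx, wmul, wtrans, inv_one, Equiv.Perm.one_apply]
    linarith
  have hviso : IsIso n w.1 := ⟨fun j => by
    have h1 := nonneg_of_mem_convexHull hμ (hconv _ (alcVertex_mem_ClA (Nat.zero_le n))) j
    rw [displacement_alcVertex_of_totIso hσ hv (by rw [muk_zero]; exact hv), muk_zero] at h1
    exact Int.cast_nonneg_iff.1 h1, hv⟩
  have hlow : ∀ j, w.1 j = 0 → (j:ℕ) ≤ (w.2⁻¹ j : Fin (2*n)) := fun j hj => by
    by_contra! hc
    have h1 := nonneg_of_mem_convexHull hμ (hconv _ (increasingPoint_mem_ClA (by omega))) j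
    have h2 := increasingPoint_lt (show w.2⁻¹ j < j from hc)
    simp only [displacement, wactR, hj] at h1
    push_cast at h1
    linarith
  have hup : ∀ j, w.1 j = 1 → ((w.2⁻¹ j : Fin (2*n)) : ℕ) ≤ j := fun j hj => by
    have h1 := hlow j.rev (by have := hv j; omega)
    rw [hπ j, Fin.val_rev, Fin.val_rev] at h1
    have := (w.2⁻¹ j).isLt
    omega
  have hGL : ∀ k < 2*n, ∀ j, om n k j ≤ valc n w k j ∧ valc n w k j ≤ om n k j + 1 :=
    fun k _ j => by
      have h1 := hviso.eq_zero_or_one j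
      have h2 := hlow j
      have h3 := hup j
      simp only [valc, wact, om]
      split_ifs <;> omega
  refine ⟨⟨?_, hGL⟩, fun k hk hiso => ?_⟩
  · have h1 := sum_eq_of_add_rev hv
    simpa [valc, wact, om] using h1
  · refine even_of_cast_mem_convexHull hμ ⟨fun j => ?_, hiso⟩ ?_
    · have := (hGL k (by omega) j).1
      simp only [muk]
      omega
    · rw [← displacement_alcVertex_of_totIso hσ hv hiso]
      exact hconv _ (alcVertex_mem_ClA hk)

/-- For `μ ∈ {μ₁, μ₂}`, `Perm^sp(μ) = Perm(μ)`: `w ∈ W̃` is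
`μ`-spin-permissible iff `w ∈ t_μ W_a` and `wx - x ∈ Conv(W°μ)` for all `x` in the
closure of the base alcove. -/
theorem spin_permissible_eq_permissible (n : ℕ) (hn : 2 ≤ n)
    (μ : Fin (2*n) → ℤ) (hμ : μ = mu1 n ∨ μ = mu2 n)
    (w : Wt n) (hw : inWt n w) :
    SpinPerm n μ w ↔ PermKR n μ w := by
  have hiso := isIso_mu hμ
  exact ⟨permissible_of_spinPerm hn hiso hw, spinPerm_of_permissible hn hiso hw⟩

end OrthLM
end

section
/- The map sending the class of an element g ∈ N(K) to the double coset PgP induces a well-defined bijection from N(K)/T(O_K) onto P∖GO_{2n}(K)/P. (Via the canonical identification of N(K)/T(O_K) with the Iwahori–Weyl group W̃ of GO_{2n}, the double cosets of the standard Iwahori subgroup P in GO_{2n}(K) are in bijection with W̃.) -/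
open Matrix

namespace OrthLM

/-- The matrix of the split symmetric bilinear form `h` on `K^{2n}`: ones on the
antidiagonal, zeros elsewhere. -/
noncomputable def Jmat (k : Type*) [Field k] (n : ℕ) :
    Matrix (Fin (2*n)) (Fin (2*n)) (LaurentSeries k) :=
  fun i j => if j = i.rev then 1 else 0

/-- The group `GO_{2n}(K)` of orthogonal similitudes: invertible matrices `g` with
`gᵀ J g = c J` for some nonzero scalar `c`. -/
def GOset (k : Type*) [Field k] (n : ℕ) :
    Set (Matrix (Fin (2*n)) (Fin (2*n)) (LaurentSeries k)) :=
  {g | IsUnit g.det ∧ ∃ c : LaurentSeries k, c ≠ 0 ∧ gᵀ * Jmat k n * g = c • Jmat k n}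

/-- The standard lattice `λ_i ⊆ K^{2n}`: for `i = 2nκ + r` with `0 ≤ r < 2n`,
`λ_i = Σ_{j=1}^{r} t^{-κ-1} O_K e_j + Σ_{j=r+1}^{2n} t^{-κ} O_K e_j`
(membership in `tᵐ·O_K` expressed via the order of a Laurent series). -/
def lam (k : Type*) [Field k] (n : ℕ) (i : ℤ) : Set (Fin (2*n) → LaurentSeries k) :=
  {x | ∀ j : Fin (2*n), x j = 0 ∨
    (if ((j:ℕ) : ℤ) < Int.emod i (2*n) then -(Int.ediv i (2*n)) - 1
     else -(Int.ediv i (2*n))) ≤ (x j).order}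

/-- The standard Iwahori subgroup `P` of `GO_{2n}(K)`: the common stabilizer of the
standard complete periodic self-dual lattice chain `(λ_i)_{i ∈ ℤ}`. -/
def Pgrp (k : Type*) [Field k] (n : ℕ) :
    Set (Matrix (Fin (2*n)) (Fin (2*n)) (LaurentSeries k)) :=
  {g | g ∈ GOset k n ∧ ∀ i : ℤ, (fun x => g.mulVec x) '' lam k n i = lam k n i}

/-- `N(K)`: the monomial matrices in `GO_{2n}(K)`. -/
def Nmono (k : Type*) [Field k] (n : ℕ) :
    Set (Matrix (Fin (2*n)) (Fin (2*n)) (LaurentSeries k)) :=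
  {g | g ∈ GOset k n ∧ ∃ σ : Equiv.Perm (Fin (2*n)), ∀ i j, g i j ≠ 0 ↔ i = σ j}

/-- `T(O_K)`: diagonal matrices in `GO_{2n}(K)` with entries in `O_K^×`. -/
def TOK (k : Type*) [Field k] (n : ℕ) :
    Set (Matrix (Fin (2*n)) (Fin (2*n)) (LaurentSeries k)) :=
  {g | g ∈ GOset k n ∧ (∀ i j, i ≠ j → g i j = 0) ∧ ∀ i, g i i ≠ 0 ∧ (g i i).order = 0}

/-! ### The adjoint involution of the antidiagonal form -/

section Adjoint

variable {F : Type*} {N : ℕ}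

/-- The transpose of a matrix along its antidiagonal, i.e. the adjoint with respect to the
antidiagonal symmetric form. -/
def adj (g : Matrix (Fin N) (Fin N) F) : Matrix (Fin N) (Fin N) F :=
  fun r s => g s.rev r.rev

lemma adj_apply (g : Matrix (Fin N) (Fin N) F) (r s : Fin N) :
    adj g r s = g s.rev r.rev := rfl

lemma adj_adj (g : Matrix (Fin N) (Fin N) F) : adj (adj g) = g := by
  ext r s
  simp [adj_apply]

variable [Field F]

lemma adj_one : adj (1 : Matrix (Fin N) (Fin N) F) = 1 := by
  ext r s
  simp [adj_apply, Matrix.one_apply, eq_comm]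

lemma adj_mul (a b : Matrix (Fin N) (Fin N) F) : adj (a * b) = adj b * adj a := by
  ext r s
  simp only [adj_apply, Matrix.mul_apply]
  rw [← Equiv.sum_comp Fin.revPerm]
  simp [mul_comm]

/-- `g` is a similitude of the antidiagonal form with multiplier `c`. -/
def IsSimilitude (g : Matrix (Fin N) (Fin N) F) (c : F) : Prop :=
  c ≠ 0 ∧ adj g * g = c • 1

namespace IsSimilitude

variable {g g' : Matrix (Fin N) (Fin N) F} {c c' : F}

lemma inv_smul_adj_mul (h : IsSimilitude g c) : (c⁻¹ • adj g) * g = 1 := by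
  rw [smul_mul_assoc, h.2, smul_smul, inv_mul_cancel₀ h.1, one_smul]

lemma inv_eq (h : IsSimilitude g c) : g⁻¹ = c⁻¹ • adj g :=
  Matrix.inv_eq_left_inv h.inv_smul_adj_mul

lemma isUnit_det (h : IsSimilitude g c) : IsUnit g.det :=
  (Matrix.isUnit_iff_isUnit_det g).1
    (IsUnit.of_mul_eq_one_right _ h.inv_smul_adj_mul)

lemma adjoint (h : IsSimilitude g c) : IsSimilitude (adj g) c := by
  refine ⟨h.1, ?_⟩
  have h1 := mul_eq_one_comm.1 h.inv_smul_adj_mul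
  rw [mul_smul_comm] at h1
  rw [adj_adj, ← h1, smul_smul, mul_inv_cancel₀ h.1, one_smul]

lemma mul (h : IsSimilitude g c) (h' : IsSimilitude g' c') :
    IsSimilitude (g * g') (c * c') := by
  refine ⟨mul_ne_zero h.1 h'.1, ?_⟩
  rw [adj_mul, mul_assoc, ← mul_assoc (adj g), h.2, smul_mul_assoc, one_mul,
    mul_smul_comm, h'.2, smul_smul]

lemma inv (h : IsSimilitude g c) : IsSimilitude g⁻¹ c⁻¹ := by
  refine ⟨inv_ne_zero h.1, ?_⟩
  have h1 := h.adjoint.2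
  rw [adj_adj] at h1
  have h2 : adj (c⁻¹ • adj g) = c⁻¹ • g := by
    ext r s
    simp [adj_apply]
  rw [h.inv_eq, h2, smul_mul_smul_comm, h1, smul_smul, mul_assoc, inv_mul_cancel₀ h.1, mul_one]

lemma sum_eq (h : IsSimilitude g c) (r s : Fin N) :
    ∑ l, g l.rev r * g l s = if r.rev = s then c else 0 := by
  have h1 := congrFun (congrFun h.2 r.rev) s
  simpa [Matrix.mul_apply, adj_apply, Matrix.one_apply] using h1

end IsSimilitude

/-- The entry `(a, b)` of `g` is the only nonzero entry in its row and in its column. -/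
structure IsIsolated (g : Matrix (Fin N) (Fin N) F) (a b : Fin N) : Prop where
  ne_zero : g a b ≠ 0
  row : ∀ s, s ≠ b → g a s = 0
  col : ∀ r, r ≠ a → g r b = 0

namespace IsIsolated

variable {g : Matrix (Fin N) (Fin N) F} {a b : Fin N} {c : F}

lemma adjoint (h : IsIsolated g a b) : IsIsolated (adj g) b.rev a.rev where
  ne_zero := by simpa [adj_apply] using h.ne_zero
  row s hs := by
    rw [adj_apply, Fin.rev_rev]
    exact h.col _ fun e => hs (by rw [← e, Fin.rev_rev])
  col r hr := by
    rw [adj_apply, Fin.rev_rev]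
    exact h.row _ fun e => hr (by rw [← e, Fin.rev_rev])

lemma of_adjoint (h : IsIsolated (adj g) b.rev a.rev) : IsIsolated g a b := by
  simpa [adj_adj] using h.adjoint

lemma mul_rev (h : IsIsolated g a b) (hg : IsSimilitude g c) (s : Fin N) :
    g a b * g a.rev s = if b.rev = s then c else 0 := by
  rw [← hg.sum_eq b s, Finset.sum_eq_single a.rev]
  · simp
  · intro l _ hl
    rw [h.col _ fun e => hl (by rw [← e, Fin.rev_rev]), zero_mul]
  · simp

lemma rev (h : IsIsolated g a b) (hg : IsSimilitude g c) : IsIsolated g a.rev b.rev where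
  ne_zero := by
    have h1 := h.mul_rev hg b.rev
    rw [if_pos rfl] at h1
    exact right_ne_zero_of_mul (h1 ▸ hg.1)
  row s hs := by
    have h1 := h.mul_rev hg s
    rw [if_neg hs.symm] at h1
    exact (mul_eq_zero.1 h1).resolve_left h.ne_zero
  col r hr := by
    have h1 := h.adjoint.mul_rev hg.adjoint r.rev
    rw [if_neg fun e => hr (Fin.rev_injective e).symm] at h1
    have h2 := (mul_eq_zero.1 h1).resolve_left h.adjoint.ne_zero
    simpa [adj_apply] using h2

end IsIsolated

/-! ### Eichler transformations -/

/-- The Eichler transformation attached to the isotropic basis vectors `e_i`, `e_{i*}`, a vector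
`u` orthogonal to both, and a scalar `b`. -/
def eichler (i : Fin N) (u : Fin N → F) (b : F) : Matrix (Fin N) (Fin N) F :=
  1 - vecMulVec u (Pi.single i 1) + vecMulVec (Pi.single i.rev 1) (fun s => u s.rev)
    + b • vecMulVec (Pi.single i.rev 1) (Pi.single i 1)

lemma eichler_apply (i : Fin N) (u : Fin N → F) (b : F) (r s : Fin N) :
    eichler i u b r s = (if r = s then 1 else 0) - (if s = i then u r else 0)
      + (if r = i.rev then u s.rev else 0) + (if r = i.rev ∧ s = i then b else 0) := by
  by_cases h1 : r = i.rev <;> by_cases h2 : s = i <;>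
    simp [eichler, vecMulVec_apply, Matrix.one_apply, h1, h2]

lemma eichler_mul_apply (i : Fin N) (u : Fin N → F) (b : F) (g : Matrix (Fin N) (Fin N) F)
    (r t : Fin N) :
    (eichler i u b * g) r t = g r t - u r * g i t
      + (if r = i.rev then ∑ s, u s.rev * g s t + b * g i t else 0) := by
  rw [Matrix.mul_apply]
  simp only [eichler_apply, add_mul, sub_mul, Finset.sum_add_distrib, Finset.sum_sub_distrib]
  by_cases h : r = i.rev <;> simp [h, add_assoc]

lemma adj_eichler (i : Fin N) (u : Fin N → F) (b : F) :
    adj (eichler i u b) = eichler i (-u) b := by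
  ext r s
  have h1 : s.rev = i.rev ↔ s = i := Fin.rev_inj
  have h2 : r.rev = i ↔ r = i.rev := Fin.rev_eq_iff
  have h3 : s.rev = r.rev ↔ r = s := by rw [Fin.rev_inj, eq_comm]
  simp only [adj_apply, eichler_apply, h1, h2, h3, Fin.rev_rev, Pi.neg_apply, and_comm]
  split_ifs <;> ring

lemma eichler_isSimilitude {i : Fin N} (hi : i.rev ≠ i) {u : Fin N → F} {b : F}
    (hui : u i = 0) (hui' : u i.rev = 0) (hb : ∑ s, u s.rev * u s + 2 * b = 0) :
    IsSimilitude (eichler i u b) 1 := by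
  refine ⟨one_ne_zero, ?_⟩
  rw [adj_eichler, one_smul]
  ext r t
  rw [eichler_mul_apply]
  have hsum : ∑ s, (-u) s.rev * eichler i u b s t
      = - u t.rev + (if t = i then ∑ s, u s.rev * u s else 0) := by
    simp only [eichler_apply, mul_add, mul_sub, Finset.sum_add_distrib, Finset.sum_sub_distrib]
    by_cases h : t = i <;> simp [h, hui]
  rw [hsum]
  simp only [eichler_apply, hui, Matrix.one_apply, Pi.neg_apply, hi.symm, false_and,
    if_false, eq_comm (a := i) (b := t)]
  have hb' := eq_neg_of_add_eq_zero_left hb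
  rw [hb']
  by_cases h1 : r = i.rev <;> by_cases h2 : t = i <;>
    simp [h1, h2, hui', hi] <;> ring

end Adjoint

/-! ### Weights of Laurent series -/

section Weight

variable {k : Type*} [Field k] {N : ℕ}

/-- `N * ord x ≥ m`, with the convention that `0` has infinite order. -/
def WeightGE (N : ℕ) (m : ℤ) (x : LaurentSeries k) : Prop :=
  x = 0 ∨ m ≤ N * x.order

namespace WeightGE

variable {m m' : ℤ} {x y : LaurentSeries k}

lemma zero : WeightGE N m (0 : LaurentSeries k) := Or.inl rfl

lemma one : WeightGE N 0 (1 : LaurentSeries k) := Or.inr (by simp)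

lemma mono (h : WeightGE N m x) (hm : m' ≤ m) : WeightGE N m' x := h.imp_right hm.trans

lemma neg (h : WeightGE N m x) : WeightGE N m (-x) := by
  simpa [WeightGE, HahnSeries.order_neg] using h

lemma add (hx : WeightGE N m x) (hy : WeightGE N m y) : WeightGE N m (x + y) := by
  by_cases h : x + y = 0
  · exact Or.inl h
  rcases hx with rfl | hx
  · simpa using hy
  rcases hy with rfl | hy
  · rw [add_zero]
    exact Or.inr hx
  refine Or.inr ?_
  have h1 := HahnSeries.min_order_le_order_add h
  rcases min_le_iff.1 h1 with h2 | h2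
  · exact hx.trans (mul_le_mul_of_nonneg_left h2 (by positivity))
  · exact hy.trans (mul_le_mul_of_nonneg_left h2 (by positivity))

lemma sub (hx : WeightGE N m x) (hy : WeightGE N m y) : WeightGE N m (x - y) := by
  rw [sub_eq_add_neg]
  exact hx.add hy.neg

lemma mul (hx : WeightGE N m x) (hy : WeightGE N m' y) : WeightGE N (m + m') (x * y) := by
  by_cases hx0 : x = 0
  · simp [hx0, zero]
  by_cases hy0 : y = 0
  · simp [hy0, zero]
  refine Or.inr ?_
  rw [HahnSeries.order_mul hx0 hy0, mul_add]
  exact add_le_add (hx.resolve_left hx0) (hy.resolve_left hy0)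

lemma sum {ι : Type*} {s : Finset ι} {f : ι → LaurentSeries k}
    (h : ∀ i ∈ s, WeightGE N m (f i)) : WeightGE N m (∑ i ∈ s, f i) :=
  Finset.sum_induction f _ (fun _ _ => add) zero h

lemma round_up (h : WeightGE N m x) (hm : 1 ≤ m) : WeightGE N N x := by
  rcases h with h | h
  · exact Or.inl h
  · refine Or.inr ?_
    have h1 : 0 < x.order := by
      by_contra hc
      have : (N : ℤ) * x.order ≤ 0 := mul_nonpos_of_nonneg_of_nonpos (by positivity) (by omega)
      omega
    nlinarith

end WeightGE

lemma not_weightGE_one (hN : 0 < N) : ¬ WeightGE N N (1 : LaurentSeries k) := by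
  rintro (h | h)
  · exact one_ne_zero h
  · rw [HahnSeries.order_one, mul_zero] at h
    omega

lemma order_inv_of_order_eq_zero {x : LaurentSeries k} (hx : x ≠ 0) (h : x.order = 0) :
    (x⁻¹).order = 0 := by
  have h1 := HahnSeries.order_mul hx (inv_ne_zero hx)
  rw [mul_inv_cancel₀ hx, HahnSeries.order_one, h] at h1
  omega

/-- The matrix `g` maps every lattice of the standard chain into itself. -/
def IsIwahoric (g : Matrix (Fin N) (Fin N) (LaurentSeries k)) : Prop :=
  ∀ r s : Fin N, WeightGE N ((r : ℤ) - s) (g r s)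

namespace IsIwahoric

variable {g g' : Matrix (Fin N) (Fin N) (LaurentSeries k)}

lemma mul (h : IsIwahoric g) (h' : IsIwahoric g') : IsIwahoric (g * g') := fun r s => by
  rw [Matrix.mul_apply]
  exact WeightGE.sum fun l _ => ((h r l).mul (h' l s)).mono (by omega)

lemma adjoint (h : IsIwahoric g) : IsIwahoric (adj g) := fun r s =>
  (h s.rev r.rev).mono (by rw [Fin.val_rev, Fin.val_rev]; omega)

lemma smul_of_order_eq_zero (h : IsIwahoric g) {c : LaurentSeries k} (hc : c.order = 0) :
    IsIwahoric (c • g) := fun r s =>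
  (WeightGE.mul (m := 0) (Or.inr (by simp [hc])) (h r s)).mono (by omega)

lemma diag (hN : 0 < N) (h : IsIwahoric g) (h' : IsIwahoric g') (hgg' : g * g' = 1)
    (i : Fin N) : g i i ≠ 0 ∧ (g i i).order = 0 := by
  have h1 := congrFun (congrFun hgg' i) i
  rw [Matrix.mul_apply, Matrix.one_apply_eq, ← Finset.add_sum_erase _ _ (Finset.mem_univ i)] at h1
  have hrest : WeightGE N N (∑ x ∈ Finset.univ.erase i, g i x * g' x i) := by
    refine WeightGE.sum fun l hl => ?_
    have hl : (l : ℕ) ≠ i := fun e => Finset.ne_of_mem_erase hl (Fin.ext e)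
    have h0 : ∀ (a b : Fin N) (x : LaurentSeries k), WeightGE N ((a : ℤ) - b) x →
        WeightGE N 0 x := by
      rintro a b x (hx | hx)
      · exact Or.inl hx
      · refine Or.inr (mul_nonneg (by positivity) ?_)
        by_contra hc
        have := a.isLt
        have := b.isLt
        nlinarith
    rcases lt_or_gt_of_ne hl with hlt | hlt
    · exact (((h i l).round_up (by omega)).mul (h0 _ _ _ (h' l i))).mono (by omega)
    · exact ((h0 _ _ _ (h i l)).mul ((h' l i).round_up (by omega))).mono (by omega)
  have hne : ¬ WeightGE N N (g i i) := fun hc => by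
    refine not_weightGE_one (k := k) hN ?_
    rw [← h1]
    exact ((hc.mul (h' i i)).mono (by omega)).add hrest
  have h2 : g i i ≠ 0 := fun e => hne (Or.inl e)
  refine ⟨h2, le_antisymm ?_ ?_⟩
  · by_contra hc
    exact hne (Or.inr (by nlinarith))
  · have h3 := (h i i).resolve_left h2
    by_contra hc
    nlinarith

end IsIwahoric

lemma eichler_isIwahoric {i : Fin N} {u : Fin N → LaurentSeries k} {b : LaurentSeries k}
    (hu : ∀ l : Fin N, WeightGE N ((l : ℤ) - i) (u l))
    (hb : WeightGE N ((i.rev : ℤ) - i) b) : IsIwahoric (eichler i u b) := by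
  intro r s
  rw [eichler_apply]
  refine WeightGE.add (WeightGE.add (WeightGE.sub ?_ ?_) ?_) ?_
  · split_ifs with h
    · exact WeightGE.one.mono (by simp [h])
    · exact WeightGE.zero
  · split_ifs with h
    · exact h ▸ hu r
    · exact WeightGE.zero
  · split_ifs with h
    · refine (hu s.rev).mono ?_
      rw [h, Fin.val_rev, Fin.val_rev]
      omega
    · exact WeightGE.zero
  · split_ifs with h
    · rw [h.1, h.2]
      exact hb
    · exact WeightGE.zero

end Weight

/-! ### The groups in terms of the adjoint involution and of weights -/

section Groups

variable {k : Type*} [Field k] {n : ℕ}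

lemma Jmat_mul_apply (g : Matrix (Fin (2*n)) (Fin (2*n)) (LaurentSeries k))
    (r s : Fin (2*n)) : (Jmat k n * g) r s = g r.rev s := by
  simp [Matrix.mul_apply, Jmat]

lemma transpose_mul_Jmat_mul (g : Matrix (Fin (2*n)) (Fin (2*n)) (LaurentSeries k)) :
    gᵀ * Jmat k n * g = Jmat k n * (adj g * g) := by
  ext r s
  rw [Jmat_mul_apply, mul_assoc, Matrix.mul_apply, Matrix.mul_apply, ← Equiv.sum_comp Fin.revPerm]
  simp [Jmat_mul_apply, adj_apply]

lemma Jmat_mul_self : Jmat k n * Jmat k n = 1 := by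
  ext r s
  rw [Jmat_mul_apply]
  simp [Jmat, Matrix.one_apply, eq_comm]

lemma mem_GOset_iff {g : Matrix (Fin (2*n)) (Fin (2*n)) (LaurentSeries k)} :
    g ∈ GOset k n ↔ ∃ c, IsSimilitude g c := by
  constructor
  · rintro ⟨-, c, hc, h⟩
    refine ⟨c, hc, ?_⟩
    have h1 := congrArg (fun a => Jmat k n * a) h
    simpa [transpose_mul_Jmat_mul, ← mul_assoc, Jmat_mul_self] using h1
  · rintro ⟨c, h⟩
    refine ⟨h.isUnit_det, c, h.1, ?_⟩
    rw [transpose_mul_Jmat_mul, h.2, mul_smul_comm, mul_one]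

lemma mem_lam_iff (i : ℤ) (x : Fin (2*n) → LaurentSeries k) :
    x ∈ lam k n i ↔ ∀ j : Fin (2*n), WeightGE (2*n) ((j : ℤ) - i - (2*n - 1)) (x j) := by
  refine forall_congr' fun j => or_congr_right ?_
  have hj := j.isLt
  have hN : (0 : ℤ) < 2 * n := by omega
  have h1 : Int.emod i (2*n) + 2*n * Int.ediv i (2*n) = i := Int.emod_add_mul_ediv i (2*n)
  have h2 : 0 ≤ Int.emod i (2*n) := Int.emod_nonneg i hN.ne'
  have h3 : Int.emod i (2*n) < 2*n := Int.emod_lt_of_pos i hN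
  generalize Int.emod i (2*n) = ρ at *
  generalize Int.ediv i (2*n) = κ at *
  generalize (x j).order = m
  push_cast
  have hj' : ((j : ℕ) : ℤ) < 2 * n := by exact_mod_cast hj
  have hj0 : (0 : ℤ) ≤ ((j : ℕ) : ℤ) := by positivity
  generalize ((j : ℕ) : ℤ) = l at *
  generalize (2 * n : ℤ) = M at *
  subst h1
  split_ifs with h
  · constructor <;> intro h4
    · nlinarith
    · by_contra hc
      have : m + κ + 2 ≤ 0 := by omega
      nlinarith
  · constructor <;> intro h4
    · nlinarith
    · by_contra hc
      have : m + κ + 1 ≤ 0 := by omega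
      nlinarith

lemma IsIwahoric.mulVec_mem_lam {g : Matrix (Fin (2*n)) (Fin (2*n)) (LaurentSeries k)}
    (h : IsIwahoric g) {i : ℤ} {x : Fin (2*n) → LaurentSeries k} (hx : x ∈ lam k n i) :
    g.mulVec x ∈ lam k n i := by
  rw [mem_lam_iff] at hx ⊢
  intro r
  simp only [Matrix.mulVec, dotProduct]
  refine WeightGE.sum fun s _ => ?_
  have h1 := (h r s).mul (hx s)
  exact h1.mono (by omega)

lemma isIwahoric_of_mulVec_mem_lam {g : Matrix (Fin (2*n)) (Fin (2*n)) (LaurentSeries k)}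
    (h : ∀ i : ℤ, ∀ x ∈ lam k n i, g.mulVec x ∈ lam k n i) : IsIwahoric g := by
  intro r s
  have h1 : Pi.single s 1 ∈ lam k n (s - (2*n - 1)) := by
    rw [mem_lam_iff]
    intro j
    by_cases hj : j = s
    · subst hj
      simpa using WeightGE.one
    · simpa [hj] using WeightGE.zero
  have h2 := (mem_lam_iff _ _).1 (h _ _ h1) r
  rw [Matrix.mulVec_single_one] at h2
  exact h2.mono (by omega)

lemma mem_Pgrp_iff {g : Matrix (Fin (2*n)) (Fin (2*n)) (LaurentSeries k)} :
    g ∈ Pgrp k n ↔ g ∈ GOset k n ∧ IsIwahoric g ∧ IsIwahoric g⁻¹ := by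
  refine and_congr_right fun hg => ?_
  have hl : g⁻¹ * g = 1 := Matrix.nonsing_inv_mul g hg.1
  have hr : g * g⁻¹ = 1 := Matrix.mul_nonsing_inv g hg.1
  constructor
  · intro h
    refine ⟨isIwahoric_of_mulVec_mem_lam fun i x hx => h i ▸ ⟨x, hx, rfl⟩,
      isIwahoric_of_mulVec_mem_lam fun i x hx => ?_⟩
    rw [← h i] at hx
    obtain ⟨y, hy, rfl⟩ := hx
    simpa [Matrix.mulVec_mulVec, hl] using hy
  · rintro ⟨h1, h2⟩ i
    refine Set.Subset.antisymm ?_ fun x hx => ⟨g⁻¹.mulVec x, h2.mulVec_mem_lam hx, ?_⟩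
    · rintro _ ⟨x, hx, rfl⟩
      exact h1.mulVec_mem_lam hx
    · simp [Matrix.mulVec_mulVec, hr]

lemma IsSimilitude.mem_Pgrp {g : Matrix (Fin (2*n)) (Fin (2*n)) (LaurentSeries k)}
    {c : LaurentSeries k} (h : IsSimilitude g c) (hc : c.order = 0) (hg : IsIwahoric g) :
    g ∈ Pgrp k n := by
  refine mem_Pgrp_iff.2 ⟨mem_GOset_iff.2 ⟨c, h⟩, hg, ?_⟩
  rw [h.inv_eq]
  exact hg.adjoint.smul_of_order_eq_zero (order_inv_of_order_eq_zero h.1 hc)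

variable {g p q : Matrix (Fin (2*n)) (Fin (2*n)) (LaurentSeries k)}

lemma mul_mem_GOset (hp : p ∈ GOset k n) (hq : q ∈ GOset k n) : p * q ∈ GOset k n := by
  obtain ⟨c, hc⟩ := mem_GOset_iff.1 hp
  obtain ⟨d, hd⟩ := mem_GOset_iff.1 hq
  exact mem_GOset_iff.2 ⟨_, hc.mul hd⟩

lemma inv_mem_GOset (hp : p ∈ GOset k n) : p⁻¹ ∈ GOset k n := by
  obtain ⟨c, hc⟩ := mem_GOset_iff.1 hp
  exact mem_GOset_iff.2 ⟨_, hc.inv⟩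

lemma one_mem_Pgrp : (1 : Matrix (Fin (2*n)) (Fin (2*n)) (LaurentSeries k)) ∈ Pgrp k n := by
  refine IsSimilitude.mem_Pgrp (c := 1) ⟨one_ne_zero, ?_⟩ HahnSeries.order_one fun r s => ?_
  · rw [adj_one, one_mul, one_smul]
  · by_cases h : r = s
    · subst h
      simpa using WeightGE.one
    · simpa [h] using WeightGE.zero

lemma mul_mem_Pgrp (hp : p ∈ Pgrp k n) (hq : q ∈ Pgrp k n) : p * q ∈ Pgrp k n := by
  rw [mem_Pgrp_iff] at *
  refine ⟨mul_mem_GOset hp.1 hq.1, hp.2.1.mul hq.2.1, ?_⟩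
  rw [Matrix.mul_inv_rev]
  exact hq.2.2.mul hp.2.2

lemma inv_mem_Pgrp (hp : p ∈ Pgrp k n) : p⁻¹ ∈ Pgrp k n := by
  rw [mem_Pgrp_iff] at *
  refine ⟨inv_mem_GOset hp.1, hp.2.2, ?_⟩
  rw [Matrix.nonsing_inv_nonsing_inv _ hp.1.1]
  exact hp.2.1

lemma adj_mem_Pgrp (hp : p ∈ Pgrp k n) : adj p ∈ Pgrp k n := by
  rw [mem_Pgrp_iff] at *
  obtain ⟨c, hc⟩ := mem_GOset_iff.1 hp.1
  refine ⟨mem_GOset_iff.2 ⟨_, hc.adjoint⟩, hp.2.1.adjoint, ?_⟩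
  have h : (adj p)⁻¹ = adj p⁻¹ := by
    refine Matrix.inv_eq_left_inv ?_
    rw [← adj_mul, Matrix.mul_nonsing_inv _ hp.1.1, adj_one]
  rw [h]
  exact hp.2.2.adjoint

lemma rev_ne_self (i : Fin (2*n)) : i.rev ≠ i := fun h => by
  have h1 := congrArg Fin.val h
  rw [Fin.val_rev] at h1
  have := i.isLt
  omega

lemma TOK_subset_Pgrp : TOK k n ⊆ Pgrp k n := by
  rintro s ⟨hs, hd, hu⟩
  have hsw : IsIwahoric s := fun a b => by
    by_cases h : a = b
    · subst h
      exact Or.inr (by simp [(hu a).2])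
    · exact Or.inl (hd a b h)
  obtain ⟨c, hc⟩ := mem_GOset_iff.1 hs
  rcases isEmpty_or_nonempty (Fin (2*n)) with he | ⟨⟨j⟩⟩
  · rw [Subsingleton.elim s 1]
    exact one_mem_Pgrp
  · refine hc.mem_Pgrp ?_ hsw
    have hj : IsIsolated s j j := ⟨(hu j).1, fun a ha => hd _ _ ha.symm, fun a ha => hd _ _ ha⟩
    have h1 := hj.mul_rev hc j.rev
    rw [if_pos rfl] at h1
    rw [← h1, HahnSeries.order_mul (hu _).1 (hu _).1, (hu _).2, (hu _).2, add_zero]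

/-! ### Elimination -/

lemma exists_clear_col {c : LaurentSeries k} (hg : IsSimilitude g c) {i j : Fin (2*n)}
    (hij : g i j ≠ 0) (hmin : ∀ l, g l j ≠ 0 →
      ((2*n : ℕ) : ℤ) * (g i j).order - i ≤ ((2*n : ℕ) : ℤ) * (g l j).order - l)
    (hni : ¬ IsIsolated g i j) :
    ∃ p ∈ Pgrp k n, (∀ a b, IsIsolated g a b → IsIsolated (p * g) a b) ∧
      (∀ r, r ≠ i → (p * g) r j = 0) ∧ ∀ s, (p * g) i s = g i s := by
  have hi := rev_ne_self i
  have hv : ∀ l : Fin (2*n), WeightGE (2*n) ((l : ℤ) - i) (g l j / g i j) := fun l => by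
    by_cases h : g l j = 0
    · exact Or.inl (by simp [h])
    · refine Or.inr ?_
      have h1 := HahnSeries.order_mul (div_ne_zero h hij) hij
      rw [div_mul_cancel₀ _ hij] at h1
      have h2 := hmin l h
      rw [h1, mul_add] at h2
      omega
  set u : Fin (2*n) → LaurentSeries k :=
    fun l => if l = i ∨ l = i.rev then 0 else g l j / g i j with hu
  set b := g i.rev j / g i j with hb
  have hui : u i = 0 := by simp [hu]
  have hui' : u i.rev = 0 := by simp [hu]
  have hu0 : ∀ a, g a j = 0 → u a = 0 := fun a ha => by simp [hu, ha]
  have hune : ∀ a, a ≠ i → a ≠ i.rev → u a * g i j = g a j := fun a h h' => by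
    simp [hu, h, h', hij]
  have hbg : b * g i j = g i.rev j := div_mul_cancel₀ _ hij
  have hiso : ∑ s, g s.rev j * g s j = 0 := by
    rw [hg.sum_eq, if_neg (rev_ne_self j)]
  have hsum : ∑ s, u s.rev * g s j + 2 * g i.rev j = 0 := by
    refine (mul_eq_zero.1 (?_ : g i j * _ = 0)).resolve_left hij
    have h1 : ∀ s, g s.rev j * g s j = g i j * (u s.rev * g s j)
        + ((if s = i then g i.rev j * g i j else 0)
          + (if s = i.rev then g i j * g i.rev j else 0)) := fun s => by
      by_cases h : s = i
      · subst h; simp [hui', hi.symm]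
      by_cases h' : s = i.rev
      · subst h'; simp [hui, hi]
      rw [← hune s.rev (by rwa [Ne, Fin.rev_eq_iff]) (by rwa [Ne, Fin.rev_inj])]
      simp only [h, h', if_false]
      ring
    rw [Finset.sum_congr rfl fun s _ => h1 s, Finset.sum_add_distrib, Finset.sum_add_distrib,
      ← Finset.mul_sum] at hiso
    simp only [Finset.sum_ite_eq', Finset.mem_univ, if_true] at hiso
    linear_combination hiso
  have hbu : ∑ s, u s.rev * u s + 2 * b = 0 := by
    refine (mul_eq_zero.1 (?_ : _ * g i j = 0)).resolve_right hij
    rw [← hsum, add_mul, Finset.sum_mul, mul_assoc, hbg]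
    congr 1
    refine Finset.sum_congr rfl fun s _ => ?_
    by_cases h : s = i
    · subst h; simp [hui']
    by_cases h' : s = i.rev
    · subst h'; simp [hui]
    rw [mul_assoc, hune s h h']
  have hsim := eichler_isSimilitude hi hui hui' hbu
  have hmul := eichler_mul_apply i u b g
  refine ⟨eichler i u b, hsim.mem_Pgrp HahnSeries.order_one (eichler_isIwahoric ?_ (hv _)),
    ?_, ?_, ?_⟩
  · intro l
    by_cases h : l = i ∨ l = i.rev
    · exact Or.inl (by simp [hu, h])
    · simpa [hu, h] using hv l
  · intro a d had
    have hai : a ≠ i := fun h => by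
      subst h
      have hjd : j = d := by
        by_contra h
        exact hij (had.row j h)
      subst hjd
      exact hni had
    have had' := had.rev hg
    have hai' : a.rev ≠ i := fun h => by
      rw [h] at had'
      have hjd : j = d.rev := by
        by_contra h
        exact hij (had'.row j h)
      rw [← hjd] at had'
      exact hni had'
    have hjd : j ≠ d := fun h => by
      subst h
      exact hij (had.col i hai.symm)
    have hjd' : j ≠ d.rev := fun h => by
      rw [h] at hij
      exact hij (had'.col i hai'.symm)
    have hua : u a = 0 := hu0 _ (had.row j hjd)
    have hua' : u a.rev = 0 := hu0 _ (had'.row j hjd')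
    have hrow : ∀ s, (eichler i u b * g) a s = g a s := fun s => by
      rw [hmul, hua, if_neg fun e => hai' (Fin.rev_eq_iff.2 e)]
      ring
    refine ⟨by rw [hrow]; exact had.ne_zero, fun s hs => by rw [hrow]; exact had.row s hs,
      fun r hr => ?_⟩
    rw [hmul, had.col r hr, had.col i hai.symm, Finset.sum_eq_zero]
    · simp
    · intro s _
      by_cases hs : s = a
      · rw [hs, hua', zero_mul]
      · rw [had.col s hs, mul_zero]
  · intro r hr
    rw [hmul]
    by_cases h : r = i.rev
    · rw [if_pos h, hbg, h, hui']
      linear_combination hsum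
    · rw [if_neg h, hune r hr h]
      ring
  · intro s
    rw [hmul, hui, if_neg hi.symm]
    ring

lemma exists_clear_row {c : LaurentSeries k} (hg : IsSimilitude g c) {i j : Fin (2*n)}
    (hij : g i j ≠ 0) (hmin : ∀ l, g i l ≠ 0 →
      ((2*n : ℕ) : ℤ) * (g i j).order + j ≤ ((2*n : ℕ) : ℤ) * (g i l).order + l)
    (hni : ¬ IsIsolated g i j) :
    ∃ q ∈ Pgrp k n, (∀ a b, IsIsolated g a b → IsIsolated (g * q) a b) ∧
      (∀ s, s ≠ j → (g * q) i s = 0) ∧ ∀ r, (g * q) r j = g r j := by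
  have happ : ∀ r, adj g r i.rev = g i r.rev := fun r => by rw [adj_apply, Fin.rev_rev]
  obtain ⟨p, hp, h1, h2, h3⟩ := exists_clear_col (i := j.rev) (j := i.rev) hg.adjoint
    (by rwa [happ, Fin.rev_rev])
    (fun l hl => by
      rw [happ] at hl
      have h4 := hmin _ hl
      rw [happ, happ, Fin.rev_rev, Fin.val_rev]
      rw [Fin.val_rev] at h4
      omega)
    (fun h => hni h.of_adjoint)
  have hadj : adj (g * adj p) = p * adj g := by rw [adj_mul, adj_adj]
  have hent : ∀ r s, (g * adj p) r s = (p * adj g) s.rev r.rev := fun r s => by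
    rw [← hadj, adj_apply, Fin.rev_rev, Fin.rev_rev]
  refine ⟨adj p, adj_mem_Pgrp hp, fun a b hab => ?_, fun s hs => ?_, fun r => ?_⟩
  · refine IsIsolated.of_adjoint ?_
    rw [hadj]
    exact h1 _ _ hab.adjoint
  · rw [hent]
    exact h2 _ (by rwa [Ne, Fin.rev_inj])
  · rw [hent, h3, adj_apply, Fin.rev_rev, Fin.rev_rev]

lemma exists_isolate {c : LaurentSeries k} (hg : IsSimilitude g c) {j₀ : Fin (2*n)}
    (hj₀ : ∀ a, ¬ IsIsolated g a j₀) :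
    ∃ p ∈ Pgrp k n, ∃ q ∈ Pgrp k n,
      (∀ a b, IsIsolated g a b → IsIsolated (p * g * q) a b) ∧
      ∃ i j, IsIsolated (p * g * q) i j ∧ ∀ a, ¬ IsIsolated g a j := by
  classical
  let S : Finset (Fin (2*n) × Fin (2*n)) :=
    Finset.univ.filter fun x => g x.1 x.2 ≠ 0 ∧ ∀ a, ¬ IsIsolated g a x.2
  have hS : S.Nonempty := by
    by_contra hc
    rw [Finset.not_nonempty_iff_eq_empty] at hc
    have h0 : ∀ i, g i j₀ = 0 := fun i => by
      by_contra h
      have : (i, j₀) ∈ S := by simp [S, h, hj₀]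
      simp [hc] at this
    have h1 := hg.sum_eq j₀.rev j₀
    simp only [h0, mul_zero, Finset.sum_const_zero, Fin.rev_rev, if_true] at h1
    exact hg.1 h1.symm
  obtain ⟨⟨i, j⟩, hmem, hmin⟩ := S.exists_min_image
    (fun x => ((2*n : ℕ) : ℤ) * (g x.1 x.2).order + x.2 - x.1) hS
  obtain ⟨hij, hj⟩ : g i j ≠ 0 ∧ ∀ a, ¬ IsIsolated g a j := by simpa [S] using hmem
  obtain ⟨p, hp, hp1, hp2, hp3⟩ := exists_clear_col hg hij (fun l hl => by
    have h1 := hmin (l, j) (by simp [S, hl, hj])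
    simp only at h1
    omega) (hj i)
  obtain ⟨d, hd⟩ := mem_GOset_iff.1 (mul_mem_GOset hp.1 (mem_GOset_iff.2 ⟨c, hg⟩))
  by_cases hcl : IsIsolated (p * g) i j
  · refine ⟨p, hp, 1, one_mem_Pgrp, ?_, i, j, ?_, hj⟩
    · simpa using hp1
    · simpa using hcl
  obtain ⟨q, hq, hq1, hq2, hq3⟩ := exists_clear_row hd (i := i) (j := j) (by rwa [hp3])
    (fun l hl => by
      rw [hp3] at hl
      rw [hp3, hp3]
      have h1 := hmin (i, l) (by
        simp only [S, Finset.mem_filter, Finset.mem_univ, true_and]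
        refine ⟨hl, fun a ha => ?_⟩
        have hia : i = a := by
          by_contra h
          exact hl (ha.col i h)
        subst hia
        have hjl : j = l := by
          by_contra h
          exact hij (ha.row j h)
        subst hjl
        exact hj _ ha)
      simp only at h1
      omega) hcl
  refine ⟨p, hp, q, hq, fun a b hab => hq1 _ _ (hp1 _ _ hab), i, j, ⟨?_, hq2, ?_⟩, hj⟩
  · rwa [hq3, hp3]
  · intro r hr
    rw [hq3, hp2 r hr]

lemma mem_Nmono_of_isolated (hg : g ∈ GOset k n) (h : ∀ b, ∃ a, IsIsolated g a b) :
    g ∈ Nmono k n := by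
  choose f hf using h
  have hinj : Function.Injective f := fun b b' hbb => by
    by_contra hne
    have h1 := (hf b).row b' (Ne.symm hne)
    rw [hbb] at h1
    exact (hf b').ne_zero h1
  refine ⟨hg, Equiv.ofBijective f (Finite.injective_iff_bijective.1 hinj), fun i j => ?_⟩
  rw [Equiv.ofBijective_apply]
  refine ⟨fun hij => ?_, fun hij => hij ▸ (hf j).ne_zero⟩
  by_contra hne
  exact hij ((hf j).col i hne)

lemma exists_mul_mem_Nmono (hg : g ∈ GOset k n) :
    ∃ p ∈ Pgrp k n, ∃ q ∈ Pgrp k n, p * g * q ∈ Nmono k n := by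
  classical
  induction hd : 2*n - (Finset.univ.filter fun b => ∃ a, IsIsolated g a b).card
    using Nat.strong_induction_on generalizing g with
  | _ d ih =>
    subst hd
    by_cases hall : ∀ b, ∃ a, IsIsolated g a b
    · refine ⟨1, one_mem_Pgrp, 1, one_mem_Pgrp, ?_⟩
      simpa using mem_Nmono_of_isolated hg hall
    push Not at hall
    obtain ⟨j₀, hj₀⟩ := hall
    obtain ⟨c, hc⟩ := mem_GOset_iff.1 hg
    obtain ⟨p, hp, q, hq, hpres, i, j, hnew, hold⟩ := exists_isolate hc hj₀
    have hlt : (Finset.univ.filter fun b => ∃ a, IsIsolated g a b).card <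
        (Finset.univ.filter fun b => ∃ a, IsIsolated (p * g * q) a b).card := by
      refine Finset.card_lt_card ((Finset.ssubset_iff_of_subset ?_).2 ⟨j, ?_, ?_⟩)
      · intro b hb
        simp only [Finset.mem_filter, Finset.mem_univ, true_and] at hb ⊢
        exact hb.imp fun a => hpres a b
      · simpa using ⟨i, hnew⟩
      · simpa using hold
    have hle := Finset.card_le_univ
      (Finset.univ.filter fun b => ∃ a, IsIsolated (p * g * q) a b)
    rw [Fintype.card_fin] at hle
    obtain ⟨p', hp', q', hq', hm⟩ := ih _ (by omega)
      (mul_mem_GOset (mul_mem_GOset hp.1 hg) hq.1) rfl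
    refine ⟨p' * p, mul_mem_Pgrp hp' hp, q * q', mul_mem_Pgrp hq hq', ?_⟩
    simpa only [mul_assoc] using hm

/-! ### Separation of double cosets -/

lemma weight_le_of_mul_eq {m₁ m₂ : Matrix (Fin (2*n)) (Fin (2*n)) (LaurentSeries k)}
    {σ₁ σ₂ : Equiv.Perm (Fin (2*n))} (h₁ : ∀ i j, m₁ i j ≠ 0 ↔ i = σ₁ j)
    (h₂ : ∀ i j, m₂ i j ≠ 0 ↔ i = σ₂ j) (hp : p ∈ Pgrp k n) (hq : q ∈ Pgrp k n)
    (h : p * m₁ = m₂ * q) (j : Fin (2*n)) :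
    ((2*n : ℕ) : ℤ) * (m₁ (σ₁ j) j).order + σ₂ j - σ₁ j
      ≤ ((2*n : ℕ) : ℤ) * (m₂ (σ₂ j) j).order := by
  rw [mem_Pgrp_iff] at hp hq
  obtain ⟨hq0, hq1⟩ := hq.2.1.diag j.pos hq.2.2 (Matrix.mul_nonsing_inv _ hq.1.1) j
  have h3 := congrFun (congrFun h (σ₂ j)) j
  rw [Matrix.mul_apply, Matrix.mul_apply, Finset.sum_eq_single (σ₁ j),
    Finset.sum_eq_single j] at h3
  · have hm₁ := (h₁ _ j).2 rfl
    have hm₂ := (h₂ _ j).2 rfl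
    have hp0 : p (σ₂ j) (σ₁ j) ≠ 0 := fun h0 => by
      rw [h0, zero_mul] at h3
      exact mul_ne_zero hm₂ hq0 h3.symm
    have h4 := congrArg HahnSeries.order h3
    rw [HahnSeries.order_mul hp0 hm₁, HahnSeries.order_mul hm₂ hq0, hq1, add_zero] at h4
    have h5 := (hp.2.1 (σ₂ j) (σ₁ j)).resolve_left hp0
    rw [← h4, mul_add]
    omega
  · intro b _ hb
    have : m₂ (σ₂ j) b = 0 := by
      by_contra h0
      exact hb (σ₂.injective ((h₂ _ _).1 h0)).symm
    rw [this, zero_mul]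
  · simp
  · intro b _ hb
    have : m₁ b j = 0 := by
      by_contra h0
      exact hb ((h₁ _ _).1 h0)
    rw [this, mul_zero]
  · simp

lemma exists_TOK_of_mem_double_coset
    {m₁ m₂ : Matrix (Fin (2*n)) (Fin (2*n)) (LaurentSeries k)} (hm₁ : m₁ ∈ Nmono k n)
    (hm₂ : m₂ ∈ Nmono k n) (hp : p ∈ Pgrp k n) (hq : q ∈ Pgrp k n) (h : m₂ = p * m₁ * q) :
    ∃ s ∈ TOK k n, m₂ = m₁ * s := by
  obtain ⟨hg₁, σ₁, h₁⟩ := hm₁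
  obtain ⟨hg₂, σ₂, h₂⟩ := hm₂
  have e₁ : p * m₁ = m₂ * q⁻¹ := by
    rw [h, mul_assoc _ q, Matrix.mul_nonsing_inv _ hq.1.1, mul_one]
  have e₂ : p⁻¹ * m₂ = m₁ * q := by
    rw [h, mul_assoc p, ← mul_assoc, Matrix.nonsing_inv_mul _ hp.1.1, one_mul]
  have key : ∀ j, σ₁ j = σ₂ j ∧ (m₁ (σ₁ j) j).order = (m₂ (σ₂ j) j).order := fun j => by
    have l₁ := weight_le_of_mul_eq h₁ h₂ hp (inv_mem_Pgrp hq) e₁ j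
    have l₂ := weight_le_of_mul_eq h₂ h₁ (inv_mem_Pgrp hp) hq e₂ j
    have b₁ := (σ₁ j).isLt
    have b₂ := (σ₂ j).isLt
    have ho : (m₁ (σ₁ j) j).order = (m₂ (σ₂ j) j).order := by
      by_contra hne
      rcases lt_or_gt_of_ne hne with hlt | hlt
      all_goals
        have h3 := mul_le_mul_of_nonneg_left (Int.add_one_le_of_lt hlt)
          (Int.natCast_nonneg (2*n))
        rw [mul_add, mul_one] at h3
        omega
    rw [ho] at l₁ l₂
    exact ⟨Fin.ext (by omega), ho⟩
  have hσ : σ₁ = σ₂ := Equiv.ext fun j => (key j).1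
  subst hσ
  have n₁ : ∀ j, m₁ (σ₁ j) j ≠ 0 := fun j => (h₁ _ _).2 rfl
  have n₂ : ∀ j, m₂ (σ₁ j) j ≠ 0 := fun j => (h₂ _ _).2 rfl
  have hs : m₂ = m₁ * Matrix.diagonal fun j => m₂ (σ₁ j) j / m₁ (σ₁ j) j := by
    ext1 i j
    rw [Matrix.mul_diagonal]
    by_cases hij : i = σ₁ j
    · rw [hij, mul_div_cancel₀ _ (n₁ j)]
    · have z₁ : m₁ i j = 0 := by
        by_contra h0
        exact hij ((h₁ _ _).1 h0)
      have z₂ : m₂ i j = 0 := by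
        by_contra h0
        exact hij ((h₂ _ _).1 h0)
      rw [z₁, z₂, zero_mul]
  refine ⟨_, ⟨?_, fun i j hij => Matrix.diagonal_apply_ne _ hij, fun j => ?_⟩, hs⟩
  · have h3 := mul_mem_GOset (inv_mem_GOset hg₁) hg₂
    rw [hs, ← mul_assoc, Matrix.nonsing_inv_mul _ hg₁.1, one_mul] at h3
    convert h3 using 4
  · rw [Matrix.diagonal_apply_eq]
    have hne := div_ne_zero (n₂ j) (n₁ j)
    refine ⟨hne, ?_⟩
    have h3 := HahnSeries.order_mul hne (n₁ j)
    rw [div_mul_cancel₀ _ (n₁ j), (key j).2] at h3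
    omega

end Groups

/-- The map `n T(O_K) ↦ P n P` is a well-defined bijection
`N(K)/T(O_K) → P∖GO_{2n}(K)/P`: every element of `GO_{2n}(K)` lies in a double coset
`P m P` with `m ∈ N(K)` (surjectivity), and two elements of `N(K)` lie in the same
double coset iff they lie in the same right `T(O_K)`-coset (well-definedness and
injectivity). -/
theorem iwahori_weyl_double_cosets (k : Type*) [Field k] (hk2 : (2 : k) ≠ 0)
    (n : ℕ) (hn : 2 ≤ n) :
    (∀ g ∈ GOset k n, ∃ m ∈ Nmono k n, ∃ p ∈ Pgrp k n, ∃ q ∈ Pgrp k n, g = p * m * q) ∧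
    (∀ m₁ ∈ Nmono k n, ∀ m₂ ∈ Nmono k n,
      ((∃ p ∈ Pgrp k n, ∃ q ∈ Pgrp k n, m₂ = p * m₁ * q) ↔
        (∃ s ∈ TOK k n, m₂ = m₁ * s))) := by
  refine ⟨fun g hg => ?_, fun m₁ hm₁ m₂ hm₂ => ⟨?_, ?_⟩⟩
  · obtain ⟨p, hp, q, hq, hm⟩ := exists_mul_mem_Nmono hg
    refine ⟨_, hm, p⁻¹, inv_mem_Pgrp hp, q⁻¹, inv_mem_Pgrp hq, ?_⟩
    rw [mul_assoc p, ← mul_assoc, Matrix.nonsing_inv_mul _ hp.1.1, one_mul, mul_assoc,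
      Matrix.mul_nonsing_inv _ hq.1.1, mul_one]
  · rintro ⟨p, hp, q, hq, h⟩
    exact exists_TOK_of_mem_double_coset hm₁ hm₂ hp hq h
  · rintro ⟨s, hs, h⟩
    exact ⟨1, one_mem_Pgrp, s, TOK_subset_Pgrp hs, by rw [one_mul, h]⟩

end OrthLM
end
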